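/- arXiv:2208.11413 — 4 statements merged into one kernel-verified Lean document; each statement's English description precedes it below -/
import Mathlib

section
/- Let n ≥ 2 and let ρ, σ ∈ L¹(Sⁿ, ℝ) with ρ ≥ 0 almost everywhere. Then there exist points a, z ∈ Sⁿ such that ∫_{Sⁿ} ρ(v) g(z·F_a(v)) π_z(F_a(v)) dv = 0 and ∫_{Sⁿ} σ(v) g(z·F_a(v)) π_z(F_a(v)) dv = 0, where both integrals are vector-valued integrals in ℝ^{n+1}. (In other words, z is a critical point of both z ↦ ∫_{Sⁿ} ρ(v) G(z·F_a(v)) dv and z ↦ ∫_{Sⁿ} σ(v) G(z·F_a(v)) dv.) -/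
open MeasureTheory Real
open scoped RealInnerProductSpace

noncomputable section

/-- The unit sphere `Sⁿ ⊆ ℝ^{n+1}`. -/
def sph (n : ℕ) : Set (EuclideanSpace ℝ (Fin (n + 1))) := Metric.sphere 0 1

/-- Reflection `R_a(z) = z - 2(z·a)a` across the hyperplane `a^⊥`. -/
def sphRefl (n : ℕ) (a z : EuclideanSpace ℝ (Fin (n + 1))) : EuclideanSpace ℝ (Fin (n + 1)) :=
  z - (2 * ⟪z, a⟫) • a

/-- The folding map `F_a` : reflect the open half-sphere `{z·a > 0}` onto `{z·a < 0}`. -/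
def fold (n : ℕ) (a z : EuclideanSpace ℝ (Fin (n + 1))) : EuclideanSpace ℝ (Fin (n + 1)) :=
  if 0 < ⟪z, a⟫ then sphRefl n a z else z

/-- Projection `π_z(w) = w - (w·z)z` onto the tangent space `z^⊥`. -/
def proj (n : ℕ) (z w : EuclideanSpace ℝ (Fin (n + 1))) : EuclideanSpace ℝ (Fin (n + 1)) :=
  w - ⟪w, z⟫ • z

/-- The open geodesic ball `B_{p,r}` on the unit sphere: points of the sphere at geodesic
(angular) distance `arccos (p·v) < r` from `p`. -/
def gball (n : ℕ) (p : EuclideanSpace ℝ (Fin (n + 1))) (r : ℝ) :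
    Set (EuclideanSpace ℝ (Fin (n + 1))) :=
  {v | v ∈ sph n ∧ Real.arccos ⟪p, v⟫ < r}

/-- `G(t) = ∫₀ᵗ g(s) ds`. -/
def Gfun (g : ℝ → ℝ) (t : ℝ) : ℝ := ∫ s in (0:ℝ)..t, g s

section piece_1

open MvPolynomial

namespace TT
set_option linter.unusedSectionVars false
set_option linter.unusedSimpArgs false
section basis
variable {ι : Type} [Fintype ι] [DecidableEq ι]

/-- polynomials of weight < m -/
noncomputable def FF (wt : ι → ℕ) (m : ℕ) : Submodule ℝ (MvPolynomial ι ℝ) :=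
  restrictSupport ℝ {γ : ι →₀ ℕ | Finsupp.weight wt γ < m}

lemma mem_FF {wt : ι → ℕ} {m : ℕ} {p : MvPolynomial ι ℝ} :
    p ∈ FF wt m ↔ ∀ γ ∈ p.support, Finsupp.weight wt γ < m := by
  unfold FF
  rw [mem_restrictSupport_iff]
  rfl

lemma FF_mono {wt : ι → ℕ} {m m' : ℕ} (h : m ≤ m') : FF wt m ≤ FF wt m' := by
  intro p hp
  rw [mem_FF] at *
  exact fun γ hγ => lt_of_lt_of_le (hp γ hγ) h

lemma FF_mul {wt : ι → ℕ} {m m' : ℕ} {p q : MvPolynomial ι ℝ} (hp : p ∈ FF wt m)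
    (hq : q ∈ FF wt (m' + 1)) : p * q ∈ FF wt (m + m') := by
  rw [mem_FF] at *
  intro γ hγ
  have := support_mul p q hγ
  rw [Finset.mem_add] at this
  obtain ⟨a, ha, b, hb, rfl⟩ := this
  have h1 := hp a ha
  have h2 := hq b hb
  rw [map_add]; omega

/-- `p` has leading monomial `γ` -/
def Lead (wt : ι → ℕ) (γ : ι →₀ ℕ) (p : MvPolynomial ι ℝ) : Prop :=
  p - monomial γ 1 ∈ FF wt (Finsupp.weight wt γ)

lemma monomial_mem_FF {wt : ι → ℕ} {m : ℕ} {γ : ι →₀ ℕ} {c : ℝ} (h : Finsupp.weight wt γ < m) :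
    monomial γ c ∈ FF wt m := by
  rw [mem_FF]
  intro δ hδ
  have := support_monomial_subset hδ
  simp at this
  rwa [this]

lemma Lead.mem {wt : ι → ℕ} {γ : ι →₀ ℕ} {p : MvPolynomial ι ℝ} (h : Lead wt γ p) :
    p ∈ FF wt (Finsupp.weight wt γ + 1) := by
  have : p = (p - monomial γ 1) + monomial γ 1 := by ring
  rw [this]
  exact Submodule.add_mem _ (FF_mono (Nat.le_succ _) h) (monomial_mem_FF (Nat.lt_succ_self _))

lemma Lead.mul {wt : ι → ℕ} {γ δ : ι →₀ ℕ} {p q : MvPolynomial ι ℝ} (hp : Lead wt γ p)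
    (hq : Lead wt δ q) : Lead wt (γ + δ) (p * q) := by
  unfold Lead
  have : p * q - monomial (γ + δ) 1 = (p - monomial γ 1) * q + (q - monomial δ 1) * monomial γ 1 := by
    have : (monomial (γ + δ) (1:ℝ)) = monomial γ 1 * monomial δ 1 := by simp [monomial_mul]
    rw [this]; ring
  rw [this, map_add]
  refine Submodule.add_mem _ (FF_mul hp hq.mem) ?_
  rw [add_comm]
  exact FF_mul hq (monomial_mem_FF (Nat.lt_succ_self _))

lemma Lead.one {wt : ι → ℕ} : Lead wt (0 : ι →₀ ℕ) (1 : MvPolynomial ι ℝ) := by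
  unfold Lead; simp

lemma Lead.pow {wt : ι → ℕ} {γ : ι →₀ ℕ} {p : MvPolynomial ι ℝ} (hp : Lead wt γ p) (k : ℕ) :
    Lead wt (k • γ) (p ^ k) := by
  induction k with
  | zero => simpa using Lead.one
  | succ k ih => rw [pow_succ, succ_nsmul]; exact ih.mul hp

lemma Lead.prod {wt : ι → ℕ} {κ : Type} (s : Finset κ) {γ : κ → (ι →₀ ℕ)}
    {p : κ → MvPolynomial ι ℝ} (hp : ∀ k, Lead wt (γ k) (p k)) :
    Lead wt (∑ k ∈ s, γ k) (∏ k ∈ s, p k) := by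
  classical
  induction s using Finset.induction_on with
  | empty => simpa using Lead.one
  | insert a s ha ih => rw [Finset.sum_insert ha, Finset.prod_insert ha]; exact (hp a).mul ih

lemma Lead.X {wt : ι → ℕ} (i : ι) : Lead wt (Finsupp.single i 1) (X i : MvPolynomial ι ℝ) := by
  unfold Lead MvPolynomial.X; simp

/-- the basis elements -/
noncomputable def TB (D : ι → ℕ) (P : ι → MvPolynomial ι ℝ) (γ : ι →₀ ℕ) : MvPolynomial ι ℝ :=
  ∏ i, (X i ^ (γ i % D i) * P i ^ (γ i / D i))

lemma TB_lead {wt D : ι → ℕ} {P : ι → MvPolynomial ι ℝ}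
    (hP : ∀ i, Lead wt (Finsupp.single i (D i)) (P i)) (γ : ι →₀ ℕ) :
    Lead wt γ (TB D P γ) := by
  have h := Lead.prod (wt := wt) Finset.univ
    (fun i => ((Lead.X (wt := wt) i).pow (γ i % D i)).mul ((hP i).pow (γ i / D i)))
  have hT : TB D P γ = ∏ k, X k ^ (γ k % D k) * P k ^ (γ k / D k) := rfl
  rw [hT]
  convert h using 1
  ext j
  rw [Finsupp.finsetSum_apply]
  rw [Finset.sum_eq_single j]
  · simp [Nat.mod_add_div']
  · intro b _ hb; simp [Finsupp.single_apply, hb]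
  · simp

lemma TB_span {wt D : ι → ℕ} {P : ι → MvPolynomial ι ℝ}
    (hP : ∀ i, Lead wt (Finsupp.single i (D i)) (P i)) :
    ⊤ ≤ Submodule.span ℝ (Set.range (TB D P)) := by
  have key : ∀ m, FF wt m ≤ Submodule.span ℝ (Set.range (TB D P)) := by
    intro m
    induction m using Nat.strong_induction_on with
    | _ m ih =>
      intro p hp
      rw [p.as_sum]
      refine Submodule.sum_mem _ fun γ hγ => ?_
      have hw := mem_FF.1 hp γ hγ
      have h1 : monomial γ (coeff γ p) = coeff γ p • (TB D P γ - (TB D P γ - monomial γ 1)) := by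
        simp [smul_monomial]
      rw [h1]
      refine Submodule.smul_mem _ _ (Submodule.sub_mem _ (Submodule.subset_span ⟨γ, rfl⟩) ?_)
      exact ih _ hw (TB_lead hP γ)
  intro p _
  refine key (∑ γ ∈ p.support, Finsupp.weight wt γ + 1) ?_
  rw [mem_FF]
  intro γ hγ
  exact Nat.lt_succ_of_le (Finset.single_le_sum (f := fun γ => Finsupp.weight wt γ) (fun _ _ => Nat.zero_le _) hγ)

lemma TB_indep {wt D : ι → ℕ} {P : ι → MvPolynomial ι ℝ}
    (hP : ∀ i, Lead wt (Finsupp.single i (D i)) (P i)) :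
    LinearIndependent ℝ (TB D P) := by
  classical
  rw [linearIndependent_iff]
  intro c hc
  by_contra hne
  have hs : c.support.Nonempty := Finsupp.support_nonempty_iff.2 hne
  obtain ⟨γ, hγ, hmax⟩ := Finset.exists_max_image c.support (fun γ => Finsupp.weight wt γ) hs
  have h := congrArg (coeff γ) hc
  rw [Finsupp.linearCombination_apply, Finsupp.sum, coeff_sum, coeff_zero,
    Finset.sum_eq_single γ] at h
  · have hz : coeff γ (TB D P γ - monomial γ 1) = 0 := by
      by_contra h0
      exact lt_irrefl _ (mem_FF.1 (TB_lead hP γ) γ (mem_support_iff.2 h0))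
    rw [coeff_sub, coeff_monomial, if_pos rfl, sub_eq_zero] at hz
    rw [coeff_smul, hz] at h
    simp at h
    exact (Finsupp.mem_support_iff.1 hγ) h
  · intro δ hδ hne
    have hz : coeff γ (TB D P δ - monomial δ 1) = 0 := by
      by_contra h0
      exact absurd (mem_FF.1 (TB_lead hP δ) γ (mem_support_iff.2 h0)) (not_lt.2 (hmax δ hδ))
    rw [coeff_sub, coeff_monomial, if_neg hne, sub_zero] at hz
    rw [coeff_smul, hz]; simp
  · intro h; exact absurd hγ h

lemma TB_mul {D : ι → ℕ} {P : ι → MvPolynomial ι ℝ} (hD : ∀ i, 0 < D i) (γ : ι →₀ ℕ) (i : ι) :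
    TB D P γ * P i = TB D P (γ + Finsupp.single i (D i)) := by
  unfold TB
  rw [← Finset.mul_prod_erase _ _ (Finset.mem_univ i), ← Finset.mul_prod_erase _ _ (Finset.mem_univ i)]
  have h1 : ∏ x ∈ Finset.univ.erase i, X x ^ ((γ + Finsupp.single i (D i)) x % D x) *
      P x ^ ((γ + Finsupp.single i (D i)) x / D x)
      = ∏ x ∈ Finset.univ.erase i, X x ^ (γ x % D x) * P x ^ (γ x / D x) := by
    refine Finset.prod_congr rfl fun x hx => ?_
    have : x ≠ i := Finset.ne_of_mem_erase hx
    simp [Finsupp.single_apply, this.symm]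
  rw [h1]
  simp only [Finsupp.add_apply, Finsupp.single_eq_same, Nat.add_mod_right, Nat.add_div_right _ (hD i)]
  ring

lemma TB_mem_ideal {D : ι → ℕ} {P : ι → MvPolynomial ι ℝ} (hD : ∀ i, 0 < D i) (γ : ι →₀ ℕ) (i : ι)
    (h : D i ≤ γ i) : TB D P γ ∈ Ideal.span (Set.range P) := by
  have : γ = (γ - Finsupp.single i (D i)) + Finsupp.single i (D i) := by
    ext j
    by_cases hj : i = j
    · subst hj; simp [h]
    · simp [hj]
  rw [this, ← TB_mul hD]
  exact Ideal.mul_mem_left _ _ (Ideal.subset_span ⟨i, rfl⟩)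

lemma ideal_le {wt D : ι → ℕ} {P : ι → MvPolynomial ι ℝ} (hD : ∀ i, 0 < D i)
    (hP : ∀ i, Lead wt (Finsupp.single i (D i)) (P i)) {p : MvPolynomial ι ℝ}
    (hp : p ∈ Ideal.span (Set.range P)) :
    p ∈ Submodule.span ℝ (TB D P '' {γ | ∃ i, D i ≤ γ i}) := by
  rw [← Ideal.submodule_span_eq] at hp
  induction hp using Submodule.span_induction with
  | mem x hx =>
    obtain ⟨i, rfl⟩ := hx
    have := TB_mul (P := P) hD 0 i
    have h0 : TB D P 0 = 1 := by simp [TB]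
    rw [h0, one_mul] at this
    rw [this]
    exact Submodule.subset_span ⟨_, ⟨i, by simp⟩, rfl⟩
  | zero => exact Submodule.zero_mem _
  | add x y _ _ hx hy => exact Submodule.add_mem _ hx hy
  | smul a x h0 hx =>
    clear h0
    have ha := TB_span hP (Submodule.mem_top (x := a))
    rw [smul_eq_mul]
    induction hx using Submodule.span_induction with
    | zero => simp
    | add x y _ _ hx hy => rw [mul_add]; exact Submodule.add_mem _ hx hy
    | smul c x _ hx => rw [mul_smul_comm]; exact Submodule.smul_mem _ _ hx
    | mem x hx =>
      obtain ⟨δ, ⟨i, hi⟩, rfl⟩ := hx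
      induction ha using Submodule.span_induction with
      | zero => simp
      | add x y _ _ hx hy => rw [add_mul]; exact Submodule.add_mem _ hx hy
      | smul c x _ hx => rw [smul_mul_assoc]; exact Submodule.smul_mem _ _ hx
      | mem a ha =>
        have hsplit : δ = (δ - Finsupp.single i (D i)) + Finsupp.single i (D i) := by
          ext j
          by_cases hj : i = j
          · subst hj; simp [hi]
          · simp [hj]
        rw [hsplit, ← TB_mul hD, ← mul_assoc]
        have ha' := TB_span hP (Submodule.mem_top (x := a * TB D P (δ - Finsupp.single i (D i))))
        generalize a * TB D P (δ - Finsupp.single i (D i)) = f at ha'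
        induction ha' using Submodule.span_induction with
        | zero => simp
        | add x y _ _ hx hy => rw [add_mul]; exact Submodule.add_mem _ hx hy
        | smul c x _ hx => rw [smul_mul_assoc]; exact Submodule.smul_mem _ _ hx
        | mem a ha =>
          obtain ⟨ε, rfl⟩ := ha
          rw [TB_mul hD]
          exact Submodule.subset_span ⟨_, ⟨i, by simp⟩, rfl⟩
end basis
end TT


end piece_1

section piece_2

namespace TT
open Module
lemma odd_root {p : Polynomial ℝ} (hm : p.Monic) (h : Odd p.natDegree) : ∃ x, p.IsRoot x := by
  have hd : 0 < p.degree := by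
    rw [← Polynomial.natDegree_pos_iff_degree_pos]; exact h.pos
  have h1 := Polynomial.tendsto_atTop_of_leadingCoeff_nonneg p hd (by rw [hm]; norm_num)
  have hnd : (p.comp (-Polynomial.X)).natDegree = p.natDegree := by
    rw [Polynomial.natDegree_comp]; simp
  have h2 := Polynomial.tendsto_atBot_of_leadingCoeff_nonpos (p.comp (-Polynomial.X))
    (by rw [← Polynomial.natDegree_pos_iff_degree_pos, hnd]; exact h.pos)
    (by rw [Polynomial.leadingCoeff_comp (by simp)]; simp [hm.leadingCoeff, h.neg_one_pow])
  obtain ⟨x, hx⟩ := (h1.eventually (Filter.eventually_ge_atTop 0)).exists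
  obtain ⟨y, hy⟩ := (h2.eventually (Filter.eventually_le_atBot 0)).exists
  have := mem_range_of_exists_le_of_exists_ge p.continuous (c := 0)
    ⟨-y, by simpa using hy⟩ ⟨x, hx⟩
  exact this
lemma odd_ideal {A : Type*} [CommRing A] [Algebra ℝ A] [FiniteDimensional ℝ A] :
    ∀ (d : ℕ) (J : Submodule A A), finrank ℝ (J.restrictScalars ℝ) = d → Odd d →
      ∃ v ∈ J, v ≠ 0 ∧ ∀ a : A, ∃ r : ℝ, a * v = r • v := by
  intro d
  induction d using Nat.strong_induction_on with
  | _ d ih =>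
  intro J hJ hd
  by_cases hsc : ∀ a : A, ∃ r : ℝ, ∀ v ∈ J, a * v = r • v
  · have : 0 < finrank ℝ (J.restrictScalars ℝ) := by rw [hJ]; exact hd.pos
    obtain ⟨⟨v, hv⟩, hne⟩ := Module.finrank_pos_iff_exists_ne_zero.1 this
    refine ⟨v, hv, fun h => hne (by ext; simpa using h), fun a => ?_⟩
    obtain ⟨r, hr⟩ := hsc a
    exact ⟨r, hr v hv⟩
  · push Not at hsc
    obtain ⟨a, ha⟩ := hsc
    let f : J.restrictScalars ℝ →ₗ[ℝ] J.restrictScalars ℝ :=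
      (LinearMap.mulLeft ℝ a).restrict (fun v hv => J.smul_mem a hv)
    have hdeg : Odd (LinearMap.charpoly f).natDegree := by
      rw [LinearMap.charpoly_natDegree, hJ]; exact hd
    obtain ⟨r, hr⟩ := odd_root (LinearMap.charpoly_monic f) hdeg
    rw [← Module.End.hasEigenvalue_iff_isRoot_charpoly] at hr
    obtain ⟨v0, hv0⟩ := hr.exists_hasEigenvector
    obtain ⟨u, hu, hur⟩ := ha r
    let b : A := a - algebraMap ℝ A r
    let h : J →ₗ[A] J := LinearMap.lsmul A J b
    let K : Submodule A A := (LinearMap.ker h).map J.subtype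
    let Rg : Submodule A A := (LinearMap.range h).map J.subtype
    let h' : J →ₗ[ℝ] J := h.restrictScalars ℝ
    have hK : finrank ℝ (K.restrictScalars ℝ) = finrank ℝ (LinearMap.ker h') := by
      have e : (LinearMap.ker h').map (J.subtype.restrictScalars ℝ) = K.restrictScalars ℝ := by
        ext x; simp [K, h']
      rw [← e]
      exact (LinearEquiv.finrank_eq (Submodule.equivMapOfInjective _ (fun x y hxy => Subtype.ext hxy) _)).symm
    have hR : finrank ℝ (Rg.restrictScalars ℝ) = finrank ℝ (LinearMap.range h') := by
      have e : (LinearMap.range h').map (J.subtype.restrictScalars ℝ) = Rg.restrictScalars ℝ := by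
        ext x; simp [Rg, h']
      rw [← e]
      exact (LinearEquiv.finrank_eq (Submodule.equivMapOfInjective _ (fun x y hxy => Subtype.ext hxy) _)).symm
    have hsum := LinearMap.finrank_range_add_finrank_ker h'
    have hJ' : finrank ℝ J = d := hJ
    have hKle : K ≤ J := by
      rintro _ ⟨x, _, rfl⟩; exact x.2
    have hRle : Rg ≤ J := by
      rintro _ ⟨x, _, rfl⟩; exact x.2
    have hmem : ∀ x : J, ((h' x : J) : A) = a * x - r • (x:A) := by
      intro x; simp [h', h, b, sub_mul, Algebra.smul_def]
    have hkerpos : 0 < finrank ℝ (LinearMap.ker h') := by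
      rw [Module.finrank_pos_iff_exists_ne_zero]
      refine ⟨⟨⟨v0.1, v0.2⟩, ?_⟩, ?_⟩
      · rw [LinearMap.mem_ker]
        ext
        rw [hmem]
        have h1 : a * (v0 : A) = r • (v0 : A) := congrArg Subtype.val hv0.apply_eq_smul
        exact sub_eq_zero.2 h1
      · intro h0; exact hv0.2 (Subtype.ext (congrArg (fun x => ((x : J) : A)) (congrArg Subtype.val h0)))
    have hrpos : 0 < finrank ℝ (LinearMap.range h') := by
      rw [Module.finrank_pos_iff_exists_ne_zero]
      refine ⟨⟨h' ⟨u, hu⟩, ⟨_, rfl⟩⟩, ?_⟩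
      intro h0
      have := congrArg (fun x => ((x : J) : A)) (congrArg Subtype.val h0)
      simp only [hmem] at this
      exact hur (sub_eq_zero.1 this)
    rcases Nat.even_or_odd (finrank ℝ (LinearMap.ker h')) with he | ho
    · have ho : Odd (finrank ℝ (LinearMap.range h')) := by
        rw [hJ'] at hsum
        rw [← hsum, Nat.odd_add] at hd
        exact hd.2 he
      obtain ⟨v, hv, h1, h2⟩ := ih _ (by omega) Rg hR ho
      exact ⟨v, hRle hv, h1, h2⟩
    · obtain ⟨v, hv, h1, h2⟩ := ih _ (by omega) K hK ho
      exact ⟨v, hKle hv, h1, h2⟩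

lemma exists_other {A : Type*} [CommRing A] [Algebra ℝ A] [FiniteDimensional ℝ A]
    (heven : Even (finrank ℝ A)) (φ₀ : A →ₐ[ℝ] ℝ)
    (hm : ∀ x : A, φ₀ x = 0 → x ∈ (RingHom.ker φ₀) ^ 2) : ∃ φ : A →ₐ[ℝ] ℝ, φ ≠ φ₀ := by
  have : IsNoetherianRing A := IsNoetherianRing.of_finite ℝ A
  set m : Ideal A := RingHom.ker φ₀ with hmdef
  have hid : IsIdempotentElem m := by
    refine le_antisymm Ideal.mul_le_left ?_
    intro x hx
    have := hm x hx
    rwa [pow_two] at this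
  obtain ⟨e, he, hme⟩ := (Ideal.isIdempotentElem_iff_of_fg m (IsNoetherian.noetherian m)).1 hid
  have hrank : finrank ℝ (Submodule.restrictScalars ℝ m) + 1 = finrank ℝ A := by
    have h := LinearMap.finrank_range_add_finrank_ker φ₀.toLinearMap
    have hs : LinearMap.range φ₀.toLinearMap = ⊤ := by
      rw [LinearMap.range_eq_top]
      intro r; exact ⟨algebraMap ℝ A r, by simp⟩
    rw [hs, finrank_top, finrank_self] at h
    have hk : LinearMap.ker φ₀.toLinearMap = Submodule.restrictScalars ℝ m := by
      ext x; simp [hmdef]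
    rw [hk] at h
    omega
  have hodd : Odd (finrank ℝ (Submodule.restrictScalars ℝ m)) := by
    rw [← hrank] at heven
    by_contra hne
    rw [Nat.not_odd_iff_even] at hne
    exact (Nat.not_even_iff_odd.2 hne.add_one) heven
  obtain ⟨v, hv, hv0, hr⟩ := odd_ideal _ m rfl hodd
  choose r hr using hr
  have inj : ∀ {s t : ℝ}, s • v = t • v → s = t := fun h => smul_left_injective ℝ hv0 h
  let φ : A →ₐ[ℝ] ℝ :=
    { toFun := r
      map_one' := inj (by rw [← hr]; simp)
      map_mul' := fun x y => inj (by
        rw [← hr, mul_assoc, hr y, mul_smul_comm, hr x, smul_smul, mul_comm])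
      map_zero' := inj (by rw [← hr]; simp)
      map_add' := fun x y => inj (by rw [← hr, add_mul, hr, hr, add_smul])
      commutes' := fun s => inj (by rw [← hr]; simp [Algebra.smul_def]) }
  refine ⟨φ, fun h => ?_⟩
  have hev : e * v = v := by
    rw [hme] at hv
    obtain ⟨c, rfl⟩ := Submodule.mem_span_singleton.1 hv
    rw [smul_eq_mul, mul_left_comm, he.eq]
  have h1 : φ e = 1 := inj (by
    change r e • v = _
    rw [← hr, hev, one_smul])
  have h2 : φ₀ e = 0 := by
    have : e ∈ m := by rw [hme]; exact Submodule.mem_span_singleton_self e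
    exact this
  rw [h, h2] at h1
  exact zero_ne_one h1
end TT


end piece_2

section piece_3

open MvPolynomial
namespace TT
set_option linter.unusedSectionVars false
set_option linter.unusedSimpArgs false
section sys
variable {κ : Type} [Fintype κ] [DecidableEq κ]

/-- sign change of block `s` -/
noncomputable def flp (s : Bool) : MvPolynomial (Bool × κ) ℝ →ₐ[ℝ] MvPolynomial (Bool × κ) ℝ :=
  aeval (fun i => if i.1 = s then -X i else X i)

lemma flp_monomial (s : Bool) (γ : Bool × κ →₀ ℕ) (c : ℝ) :
    flp s (monomial γ c) = ((-1 : ℝ) ^ (∑ o, γ (s, o))) • monomial γ c := by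
  have h : (monomial γ c : MvPolynomial (Bool × κ) ℝ) = C c * ∏ i, X i ^ γ i := by
    rw [monomial_eq, Finsupp.prod_fintype]; simp
  rw [h, map_mul, map_prod]
  have h2 : ∏ i, flp s (X i ^ γ i) = C ((-1 : ℝ) ^ (∑ o, γ (s, o))) * ∏ i, (X i ^ γ i : MvPolynomial (Bool × κ) ℝ) := by
    have : ∀ i : Bool × κ, flp s (X i ^ γ i) = (if i.1 = s then (-1) ^ γ i else 1) * X i ^ γ i := by
      intro i
      rw [map_pow, flp, aeval_X]
      split_ifs
      · rw [neg_pow]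
      · simp
    rw [Finset.prod_congr rfl (fun i _ => this i), Finset.prod_mul_distrib]
    congr 1
    rw [Fintype.prod_prod_type]
    cases s <;> simp [Finset.prod_pow_eq_pow_sum]
  rw [h2]
  have h3 : flp s (C c : MvPolynomial (Bool × κ) ℝ) = C c := by simp [flp]
  rw [h3, smul_eq_C_mul]; ring

lemma coeff_flp (s : Bool) (p : MvPolynomial (Bool × κ) ℝ) (γ : Bool × κ →₀ ℕ) :
    coeff γ (flp s p) = (-1 : ℝ) ^ (∑ o, γ (s, o)) * coeff γ p := by
  induction p using MvPolynomial.induction_on' with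
  | monomial δ c =>
    rw [flp_monomial, coeff_smul, coeff_monomial]
    split_ifs with h
    · rw [h, smul_eq_mul]
    · simp
  | add p q hp hq => rw [map_add, coeff_add, coeff_add, hp, hq]; ring

lemma eval_flp (s : Bool) (p : MvPolynomial (Bool × κ) ℝ) (x : Bool × κ → ℝ) :
    eval x (flp s p) = eval (fun i => if i.1 = s then - x i else x i) p := by
  induction p using MvPolynomial.induction_on with
  | C a => simp [flp]
  | add p q hp hq => simp [hp, hq]
  | mul_X p i hp =>
    rw [map_mul, map_mul, hp, map_mul, flp, aeval_X, eval_X]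
    split_ifs <;> simp [*]

/-- bi-even polynomials -/
noncomputable def R0 (κ : Type) : Subalgebra ℝ (MvPolynomial (Bool × κ) ℝ) :=
  Algebra.adjoin ℝ {p | ∃ s i j, p = X (s, i) * X (s, j)}

lemma R0_gen (s : Bool) (i j : κ) : X (s, i) * X (s, j) ∈ R0 κ :=
  Algebra.subset_adjoin ⟨s, i, j, rfl⟩

lemma R0_fix {p : MvPolynomial (Bool × κ) ℝ} (hp : p ∈ R0 κ) (s : Bool) : flp s p = p := by
  unfold R0 at hp
  induction hp using Algebra.adjoin_induction with
  | mem x hx =>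
    obtain ⟨t, i, j, rfl⟩ := hx
    simp only [flp, map_mul, aeval_X]
    split_ifs <;> ring
  | algebraMap r => simp [flp]
  | add x y _ _ hx hy => rw [map_add, hx, hy]
  | mul x y _ _ hx hy => rw [map_mul, hx, hy]

/-- parity predicate -/
def Ev (s : Bool) (k : ℕ) (p : MvPolynomial (Bool × κ) ℝ) : Prop :=
  (Even k → p ∈ R0 κ) ∧ (Odd k → ∀ j, p * X (s, j) ∈ R0 κ)

lemma Ev.mulX {s : Bool} {k : ℕ} {p : MvPolynomial (Bool × κ) ℝ} (h : Ev s k p) (a : κ) :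
    Ev s (k + 1) (p * X (s, a)) := by
  constructor
  · intro he
    exact h.2 (by simpa [Nat.even_add_one] using he) a
  · intro ho j
    rw [mul_assoc]
    exact (R0 κ).mul_mem (h.1 (by simpa [Nat.odd_add_one] using ho)) (R0_gen _ _ _)

lemma Ev.mulXpow {s : Bool} {k : ℕ} {p : MvPolynomial (Bool × κ) ℝ} (h : Ev s k p) (a : κ) (e : ℕ) :
    Ev s (k + e) (p * X (s, a) ^ e) := by
  induction e with
  | zero => simpa using h
  | succ e ih => rw [pow_succ, ← mul_assoc, ← add_assoc]; exact ih.mulX a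

lemma Ev_prod (s : Bool) (e : κ → ℕ) (S : Finset κ) :
    Ev s (∑ o ∈ S, e o) (∏ o ∈ S, X (s, o) ^ e o : MvPolynomial (Bool × κ) ℝ) := by
  induction S using Finset.induction_on with
  | empty => exact ⟨fun _ => by simpa using (R0 κ).one_mem, fun h => by simp at h⟩
  | insert a S ha ih =>
    rw [Finset.sum_insert ha, Finset.prod_insert ha, add_comm, mul_comm]
    exact ih.mulXpow a _

lemma even_mem {p : MvPolynomial (Bool × κ) ℝ} (hp : ∀ s, flp s p = p) : p ∈ R0 κ := by
  rw [p.as_sum]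
  refine (R0 κ).sum_mem fun γ hγ => ?_
  rw [mem_support_iff] at hγ
  have hev : ∀ s, Even (∑ o, γ (s, o)) := by
    intro s
    by_contra hne
    rw [Nat.not_even_iff_odd] at hne
    have := coeff_flp s p γ
    rw [hp s, hne.neg_one_pow] at this
    exact hγ (by linarith)
  have h : (monomial γ (coeff γ p) : MvPolynomial (Bool × κ) ℝ) =
      (coeff γ p) • ((∏ o, X (true, o) ^ γ (true, o)) * ∏ o, X (false, o) ^ γ (false, o)) := by
    rw [monomial_eq, Finsupp.prod_fintype _ _ (by simp), Fintype.prod_prod_type, smul_eq_C_mul]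
    simp
  rw [h]
  exact (R0 κ).smul_mem ((R0 κ).mul_mem ((Ev_prod true _ _).1 (hev true))
    ((Ev_prod false _ _).1 (hev false))) _

lemma flp_TB {D : Bool × κ → ℕ} {P : Bool × κ → MvPolynomial (Bool × κ) ℝ}
    (hf : ∀ s i, flp s (P i) = C (if i.1 = s then (-1 : ℝ) ^ D i else 1) * P i)
    (s : Bool) (γ : Bool × κ →₀ ℕ) :
    flp s (TB D P γ) = ((-1 : ℝ) ^ (∑ o, γ (s, o))) • TB D P γ := by
  have : ∀ i : Bool × κ, flp s (X i ^ (γ i % D i) * P i ^ (γ i / D i)) =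
      C (if i.1 = s then (-1) ^ γ i else 1) * (X i ^ (γ i % D i) * P i ^ (γ i / D i)) := by
    intro i
    rw [map_mul, map_pow, map_pow, hf s i]
    have hX : flp s (X i) = C (if i.1 = s then (-1 : ℝ) else 1) * X i := by
      rw [flp, aeval_X]; split_ifs <;> simp
    rw [hX]
    split_ifs
    · have hs : (C ((-1 : ℝ) ^ γ i) : MvPolynomial (Bool × κ) ℝ) =
          C (-1) ^ (γ i % D i) * (C ((-1) ^ D i)) ^ (γ i / D i) := by
        rw [← C_pow, ← C_pow, ← C_mul, ← pow_mul, ← pow_add, Nat.mod_add_div]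
      rw [hs]; ring
    · simp
  unfold TB
  rw [map_prod, Finset.prod_congr rfl (fun i _ => this i), Finset.prod_mul_distrib, smul_eq_C_mul]
  congr 1
  rw [Fintype.prod_prod_type]
  cases s <;> simp [Finset.prod_pow_eq_pow_sum]

end sys
end TT


end piece_3

section piece_4

open MvPolynomial
namespace TT
set_option linter.unusedSectionVars false
set_option linter.unusedSimpArgs false
section sys2
variable {κ : Type} [Fintype κ] [DecidableEq κ]

/-- standard bi-even exponents -/
noncomputable def Sd (D : Bool × κ → ℕ) : Finset (Bool × κ →₀ ℕ) :=
  (Finset.Iic (Finsupp.equivFunOnFinite.symm (fun i => D i - 1))).filter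
    (fun γ => ∀ s, Even (∑ o, γ (s, o)))

lemma mem_Sd {D : Bool × κ → ℕ} (hD : ∀ i, 0 < D i) {γ : Bool × κ →₀ ℕ} :
    γ ∈ Sd D ↔ (∀ i, γ i < D i) ∧ ∀ s, Even (∑ o, γ (s, o)) := by
  unfold Sd
  rw [Finset.mem_filter, Finset.mem_Iic, Finsupp.le_def]
  refine and_congr (forall_congr' fun i => ?_) Iff.rfl
  have := hD i
  simp only [Finsupp.equivFunOnFinite_symm_apply_apply]
  omega

/-- swap 2k and 2k+1 -/
def tog (k : ℕ) : ℕ := if k % 2 = 0 then k + 1 else k - 1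

lemma tog_tog (k : ℕ) : tog (tog k) = k := by unfold tog; split_ifs <;> omega
lemma tog_ne (k : ℕ) : tog k ≠ k := by unfold tog; split_ifs <;> omega
lemma tog_lt {k d : ℕ} (hd : Even d) (h : k < d) : tog k < d := by
  obtain ⟨e, rfl⟩ := hd
  unfold tog; split_ifs <;> omega
lemma tog_par (k : ℕ) : (tog k) % 2 = (k + 1) % 2 := by unfold tog; split_ifs <;> omega

lemma Sd_even {D : Bool × κ → ℕ} (hD : ∀ i, 0 < D i) (s : Bool) (u v : κ) (huv : u ≠ v)
    (hu : Even (D (s, u))) (hv : Even (D (s, v))) : Even (Sd D).card := by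
  let T : (Bool × κ →₀ ℕ) → (Bool × κ →₀ ℕ) := fun γ =>
    Finsupp.equivFunOnFinite.symm (fun i => if i = (s, u) ∨ i = (s, v) then tog (γ i) else γ i)
  have hT : ∀ γ i, T γ i = if i = (s, u) ∨ i = (s, v) then tog (γ i) else γ i := fun γ i => rfl
  have h : ∑ x ∈ Sd D, (1 : ZMod 2) = 0 := by
    refine Finset.sum_involution (fun γ _ => T γ) ?_ ?_ ?_ ?_
    · intros; decide
    · intro γ _ _ h0
      have := DFunLike.congr_fun h0 (s, u)
      rw [hT, if_pos (Or.inl rfl)] at this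
      exact tog_ne _ this
    · intro γ hγ
      rw [mem_Sd hD] at *
      refine ⟨fun i => ?_, fun t => ?_⟩
      · rw [hT]
        split_ifs with h
        · rcases h with rfl | rfl
          · exact tog_lt hu (hγ.1 _)
          · exact tog_lt hv (hγ.1 _)
        · exact hγ.1 i
      · have hγt := hγ.2 t
        by_cases hts : t = s
        · subst hts
          have hv' : v ∈ Finset.univ.erase u := by simp [huv.symm]
          rw [← Finset.add_sum_erase _ _ (Finset.mem_univ u), ← Finset.add_sum_erase _ _ hv'] at hγt ⊢
          have h3 : ∑ x ∈ (Finset.univ.erase u).erase v, T γ (t, x) = ∑ x ∈ (Finset.univ.erase u).erase v, γ (t, x) := by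
            refine Finset.sum_congr rfl fun x hx => ?_
            simp only [Finset.mem_erase] at hx
            rw [hT, if_neg]; simp [hx.1, hx.2.1]
          rw [h3, hT, hT, if_pos (Or.inl rfl), if_pos (Or.inr rfl)]
          have h1 := tog_par (γ (t, u))
          have h2 := tog_par (γ (t, v))
          rw [Nat.even_iff] at *
          omega
        · have : ∀ o, T γ (t, o) = γ (t, o) := by
            intro o; rw [hT, if_neg]; simp [hts]
          simp only [this]; exact hγt
    · intro γ _
      ext i
      rw [hT, hT]
      split_ifs with h
      · exact tog_tog _
      · rfl
  rw [Finset.sum_const, nsmul_one] at h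
  rwa [ZMod.natCast_eq_zero_iff_even] at h

/-- ideal -/
noncomputable abbrev II (P : Bool × κ → MvPolynomial (Bool × κ) ℝ) : Ideal (MvPolynomial (Bool × κ) ℝ) :=
  Ideal.span (Set.range P)

/-- even part of quotient -/
noncomputable def B0 (P : Bool × κ → MvPolynomial (Bool × κ) ℝ) :
    Subalgebra ℝ (MvPolynomial (Bool × κ) ℝ ⧸ II P) :=
  (R0 κ).map (Ideal.Quotient.mkₐ ℝ (II P))

lemma mk_indep {wt D : Bool × κ → ℕ} {P : Bool × κ → MvPolynomial (Bool × κ) ℝ} (hD : ∀ i, 0 < D i)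
    (hP : ∀ i, Lead wt (Finsupp.single i (D i)) (P i)) :
    LinearIndependent ℝ (fun γ : Sd D => Ideal.Quotient.mkₐ ℝ (II P) (TB D P γ)) := by
  have hind := TB_indep hP
  have h1 : LinearIndependent ℝ (fun γ : Sd D => TB D P γ) :=
    hind.comp (fun γ : Sd D => (γ : Bool × κ →₀ ℕ)) Subtype.val_injective
  refine LinearIndependent.map (f := (Ideal.Quotient.mkₐ ℝ (II P)).toLinearMap) h1 ?_
  have hdis := hind.disjoint_span_image (s := {γ | γ ∈ Sd D}) (t := {γ | ∃ i, D i ≤ γ i}) (by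
    rw [Set.disjoint_left]
    rintro γ h ⟨i, hi⟩
    exact absurd ((mem_Sd hD).1 h |>.1 i) (not_lt.2 hi))
  refine hdis.mono ?_ ?_
  · apply le_of_eq
    congr 1
    ext x; simp
  · intro p hp
    rw [LinearMap.mem_ker] at hp
    refine ideal_le hD hP ?_
    exact Ideal.Quotient.eq_zero_iff_mem.1 hp

lemma B0_span {wt D : Bool × κ → ℕ} {P : Bool × κ → MvPolynomial (Bool × κ) ℝ} (hD : ∀ i, 0 < D i)
    (hP : ∀ i, Lead wt (Finsupp.single i (D i)) (P i))
    (hf : ∀ s i, flp s (P i) = C (if i.1 = s then (-1 : ℝ) ^ D i else 1) * P i) :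
    Subalgebra.toSubmodule (B0 P) =
      Submodule.span ℝ (Set.range (fun γ : Sd D => Ideal.Quotient.mkₐ ℝ (II P) (TB D P γ))) := by
  apply le_antisymm
  · rintro _ ⟨p, hp, rfl⟩
    have hpt := TB_span hP (Submodule.mem_top (x := p))
    rw [Finsupp.mem_span_range_iff_exists_finsupp] at hpt
    obtain ⟨c, hc⟩ := hpt
    have hpar : ∀ γ s, c γ ≠ 0 → Even (∑ o, γ (s, o)) := by
      intro γ s hγ
      by_contra hne
      rw [Nat.not_even_iff_odd] at hne
      have hfix := R0_fix hp s
      let c' : (Bool × κ →₀ ℕ) →₀ ℝ := Finsupp.ofSupportFinite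
        (fun γ => (-1 : ℝ) ^ (∑ o, γ (s, o)) * c γ) (c.support.finite_toSet.subset (by
          intro δ hδ
          simp at hδ ⊢
          exact hδ))
      have h1 : Finsupp.linearCombination ℝ (TB D P) c' = Finsupp.linearCombination ℝ (TB D P) c := by
        have e1 : Finsupp.linearCombination ℝ (TB D P) c = p := hc
        rw [e1]
        conv_rhs => rw [← hfix, ← hc]
        rw [Finsupp.sum, map_sum, Finsupp.linearCombination_apply, Finsupp.sum]
        have hsub : c'.support ⊆ c.support := by
          intro δ hδ
          rw [Finsupp.mem_support_iff] at hδ ⊢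
          exact right_ne_zero_of_mul hδ
        rw [Finset.sum_subset hsub]
        · refine Finset.sum_congr rfl fun δ _ => ?_
          rw [map_smul, flp_TB hf, smul_smul, mul_comm]
          rfl
        · intro δ _ hδ
          rw [Finsupp.notMem_support_iff] at hδ
          rw [hδ, zero_smul]
      have h2 := DFunLike.congr_fun ((TB_indep hP) h1) γ
      have h3 : (-1 : ℝ) ^ (∑ o, γ (s, o)) * c γ = c γ := h2
      rw [hne.neg_one_pow] at h3
      exact hγ (by linarith)
    change Ideal.Quotient.mkₐ ℝ (II P) p ∈ _
    rw [← hc, Finsupp.sum, map_sum]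
    refine Submodule.sum_mem _ fun γ hγ => ?_
    rw [map_smul]
    refine Submodule.smul_mem _ _ ?_
    by_cases hst : ∀ i, γ i < D i
    · exact Submodule.subset_span ⟨⟨γ, (mem_Sd hD).2 ⟨hst, fun s => hpar γ s (Finsupp.mem_support_iff.1 hγ)⟩⟩, rfl⟩
    · push Not at hst
      obtain ⟨i, hi⟩ := hst
      have : Ideal.Quotient.mkₐ ℝ (II P) (TB D P γ) = 0 :=
        Ideal.Quotient.eq_zero_iff_mem.2 (TB_mem_ideal hD γ i hi)
      rw [this]; exact Submodule.zero_mem _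
  · rw [Submodule.span_le]
    rintro _ ⟨⟨γ, hγ⟩, rfl⟩
    refine ⟨TB D P γ, ?_, rfl⟩
    refine even_mem fun s => ?_
    rw [flp_TB hf, (((mem_Sd hD).1 hγ).2 s).neg_one_pow, one_smul]

lemma B0_fin {wt D : Bool × κ → ℕ} {P : Bool × κ → MvPolynomial (Bool × κ) ℝ} (hD : ∀ i, 0 < D i)
    (hP : ∀ i, Lead wt (Finsupp.single i (D i)) (P i))
    (hf : ∀ s i, flp s (P i) = C (if i.1 = s then (-1 : ℝ) ^ D i else 1) * P i) :
    FiniteDimensional ℝ (B0 P) ∧ Module.finrank ℝ (B0 P) = (Sd D).card := by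
  have h := B0_span hD hP hf
  constructor
  · change FiniteDimensional ℝ (Subalgebra.toSubmodule (B0 P))
    rw [h]
    exact FiniteDimensional.span_of_finite ℝ (Set.finite_range _)
  · change Module.finrank ℝ (Subalgebra.toSubmodule (B0 P)) = _
    rw [h, finrank_span_eq_card (mk_indep hD hP)]
    simp

end sys2
end TT


end piece_4

section piece_5

open MvPolynomial
namespace TT
set_option linter.unusedSectionVars false
set_option linter.unusedSimpArgs false
section sys3
variable {κ : Type} [Fintype κ] [DecidableEq κ]

/-- the projection from even polynomials -/
noncomputable def Phi (P : Bool × κ → MvPolynomial (Bool × κ) ℝ) : R0 κ →ₐ[ℝ] B0 P :=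
  (Ideal.Quotient.mkₐ ℝ (II P)).subalgebraMap (R0 κ)

lemma Phi_surj (P : Bool × κ → MvPolynomial (Bool × κ) ℝ) : Function.Surjective (Phi P) :=
  AlgHom.subalgebraMap_surjective _ _

lemma Phi_eq {P : Bool × κ → MvPolynomial (Bool × κ) ℝ} {p q : R0 κ}
    (h : (p : MvPolynomial (Bool × κ) ℝ) - q ∈ II P) : Phi P p = Phi P q := by
  apply Subtype.ext
  exact Ideal.Quotient.eq.2 h

/-- evaluation at a common zero -/
noncomputable def phiAt (P : Bool × κ → MvPolynomial (Bool × κ) ℝ) (x : Bool × κ → ℝ)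
    (hx : ∀ i, eval x (P i) = 0) : B0 P →ₐ[ℝ] ℝ :=
  (Ideal.Quotient.liftₐ (II P) (aeval x) (by
    intro a ha
    have : II P ≤ RingHom.ker (aeval x : MvPolynomial (Bool × κ) ℝ →ₐ[ℝ] ℝ) := by
      rw [Ideal.span_le]
      rintro _ ⟨i, rfl⟩
      exact hx i
    exact this ha)).comp (B0 P).val

lemma phiAt_Phi (P : Bool × κ → MvPolynomial (Bool × κ) ℝ) (x : Bool × κ → ℝ)
    (hx : ∀ i, eval x (P i) = 0) (r : R0 κ) : phiAt P x hx (Phi P r) = eval x (r : MvPolynomial (Bool × κ) ℝ) := by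
  rfl

/-- generators of R0 -/
noncomputable def gn (s : Bool) (i j : κ) : R0 κ := ⟨X (s, i) * X (s, j), R0_gen s i j⟩

lemma R0_ind (C' : R0 κ → Prop) (h1 : ∀ s i j, C' (gn s i j)) (h2 : ∀ r : ℝ, C' (algebraMap ℝ _ r))
    (h3 : ∀ x y, C' x → C' y → C' (x + y)) (h4 : ∀ x y, C' x → C' y → C' (x * y)) (r : R0 κ) : C' r := by
  obtain ⟨r, hr⟩ := r
  unfold R0 at hr
  induction hr using Algebra.adjoin_induction with
  | mem x hx =>
    obtain ⟨t, i, j, rfl⟩ := hx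
    exact h1 t i j
  | algebraMap r => exact h2 r
  | add x y hx' hy' hx hy => exact h3 _ _ hx hy
  | mul x y hx' hy' hx hy => exact h4 _ _ hx hy

lemma real_point (f : R0 κ →ₐ[ℝ] ℝ) (hs : ∀ s, ∑ i, f (gn s i i) = 1) :
    ∃ x : Bool × κ → ℝ, ∀ r : R0 κ, f r = eval x (r : MvPolynomial (Bool × κ) ℝ) := by
  have hM : ∀ s i j k l, f (gn s i j) * f (gn s k l) = f (gn s i k) * f (gn s j l) := by
    intro s i j k l
    rw [← map_mul, ← map_mul]
    congr 1
    apply Subtype.ext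
    simp only [gn, MulMemClass.mk_mul_mk]
    ring
  have hsym : ∀ s i j, f (gn s i j) = f (gn s j i) := by
    intro s i j
    congr 1
    apply Subtype.ext
    simp only [gn]
    ring
  have hk : ∀ s, ∃ k, 0 < f (gn s k k) := by
    intro s
    by_contra! h
    have := Finset.sum_nonpos (s := Finset.univ) (fun i _ => h i)
    rw [hs s] at this
    linarith
  choose k hk using hk
  refine ⟨fun i => f (gn i.1 i.2 (k i.1)) / Real.sqrt (f (gn i.1 (k i.1) (k i.1))), ?_⟩
  apply R0_ind
  · intro s i j
    have h0 : ((gn s i j : R0 κ) : MvPolynomial (Bool × κ) ℝ) = X (s, i) * X (s, j) := rfl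
    rw [h0, map_mul, eval_X, eval_X]
    have h1 := Real.sq_sqrt (hk s).le
    have h2 := Real.sqrt_pos.2 (hk s)
    simp only []
    rw [div_mul_div_comm, ← sq, h1, eq_div_iff (hk s).ne']
    exact hM _ _ _ _ _
  · intro r
    rw [f.commutes]
    change r = eval _ (algebraMap ℝ (MvPolynomial (Bool × κ) ℝ) r)
    simp [MvPolynomial.algebraMap_eq]
  · intro x y hx hy
    rw [map_add, hx, hy]; simp
  · intro x y hx hy
    rw [map_mul, hx, hy]; simp

lemma ext_hom {P : Bool × κ → MvPolynomial (Bool × κ) ℝ} {f g : B0 P →ₐ[ℝ] ℝ}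
    (h : ∀ s i j, f (Phi P (gn s i j)) = g (Phi P (gn s i j))) : f = g := by
  ext y
  obtain ⟨r, rfl⟩ := Phi_surj P y
  revert r
  apply R0_ind
  · exact h
  · intro r; simp
  · intro x y hx hy; simp [hx, hy]
  · intro x y hx hy; simp [hx, hy]

lemma m2_all {P : Bool × κ → MvPolynomial (Bool × κ) ℝ} (f : B0 P →ₐ[ℝ] ℝ)
    (h : ∀ s i j, Phi P (gn s i j) - algebraMap ℝ _ (f (Phi P (gn s i j))) ∈ (RingHom.ker f) ^ 2) (y : B0 P)
    (hy : f y = 0) : y ∈ (RingHom.ker f) ^ 2 := by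
  have key : ∀ r : R0 κ, Phi P r - algebraMap ℝ _ (f (Phi P r)) ∈ (RingHom.ker f) ^ 2 := by
    apply R0_ind
    · exact h
    · intro r; simp
    · intro x y hx hy
      have : Phi P (x + y) - algebraMap ℝ _ (f (Phi P (x + y))) = (Phi P x - algebraMap ℝ _ (f (Phi P x))) + (Phi P y - algebraMap ℝ _ (f (Phi P y))) := by
        simp only [map_add]; ring
      rw [this]; exact Ideal.add_mem _ hx hy
    · intro x y hx hy
      have : Phi P (x * y) - algebraMap ℝ _ (f (Phi P (x * y))) = Phi P y * (Phi P x - algebraMap ℝ _ (f (Phi P x))) + algebraMap ℝ _ (f (Phi P x)) * (Phi P y - algebraMap ℝ _ (f (Phi P y))) := by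
        simp only [map_mul]; ring
      rw [this]; exact Ideal.add_mem _ (Ideal.mul_mem_left _ _ hx) (Ideal.mul_mem_left _ _ hy)
  obtain ⟨r, rfl⟩ := Phi_surj P y
  simpa [hy] using key r

lemma m2_abs {B J : Type*} [CommRing B] [Fintype J] (m : Ideal B) (bb ww : J → J → B) (tb cw p q r t : J → B)
    (tt cc e : B) (hbb : ∀ j k, bb j k ∈ m) (hww : ∀ j k, ww j k ∈ m) (htb : ∀ j, tb j ∈ m) (hcw : ∀ j, cw j ∈ m)
    (h1 : ∀ j k, bb j k = tb j * tb k + ∑ l, bb j l * bb l k)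
    (h2 : ∀ i, tb i = - ((∑ l, bb l l) * p i + e * (bb i i * r i)))
    (h3 : tt - 1 = - ∑ l, bb l l)
    (h4 : ∀ j k, ww j k = cw j * cw k + ∑ l, ww j l * ww l k)
    (h5 : ∀ i, cw i = (∑ l, bb l l) * (cw i - q i) - e * (cw i * ww i i * t i))
    (h6 : cc - 1 = - ∑ l, ww l l) :
    (∀ j k, bb j k ∈ m ^ 2) ∧ (∀ j, tb j ∈ m ^ 2) ∧ (tt - 1 ∈ m ^ 2) ∧ (∀ j k, ww j k ∈ m ^ 2) ∧
    (∀ j, cw j ∈ m ^ 2) ∧ (cc - 1 ∈ m ^ 2) := by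
  have mm : ∀ x y, x ∈ m → y ∈ m → x * y ∈ m ^ 2 := fun x y hx hy => by
    rw [pow_two]; exact Ideal.mul_mem_mul hx hy
  have b : ∀ j k, bb j k ∈ m ^ 2 := fun j k => by
    rw [h1]; exact Ideal.add_mem _ (mm _ _ (htb _) (htb _)) (Ideal.sum_mem _ fun l _ => mm _ _ (hbb _ _) (hbb _ _))
  have w : ∀ j k, ww j k ∈ m ^ 2 := fun j k => by
    rw [h4]; exact Ideal.add_mem _ (mm _ _ (hcw _) (hcw _)) (Ideal.sum_mem _ fun l _ => mm _ _ (hww _ _) (hww _ _))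
  have sb : ∑ l, bb l l ∈ m ^ 2 := Ideal.sum_mem _ fun l _ => b _ _
  refine ⟨b, fun j => ?_, ?_, w, fun j => ?_, ?_⟩
  · rw [h2]
    exact Ideal.neg_mem_iff _ |>.2 (Ideal.add_mem _ (Ideal.mul_mem_right _ _ sb) (Ideal.mul_mem_left _ _ (Ideal.mul_mem_right _ _ (b _ _))))
  · rw [h3]; exact Ideal.neg_mem_iff _ |>.2 sb
  · rw [h5]
    exact Ideal.sub_mem _ (Ideal.mul_mem_right _ _ sb) (Ideal.mul_mem_left _ _ (Ideal.mul_mem_right _ _ (mm _ _ (hcw _) (hww _ _))))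
  · rw [h6]; exact Ideal.neg_mem_iff _ |>.2 (Ideal.sum_mem _ fun l _ => w _ _)

lemma FF_of_deg {ι : Type} [Fintype ι] [DecidableEq ι] {wt : ι → ℕ} (hw : ∀ i, wt i ≤ 2) {p : MvPolynomial ι ℝ} {m : ℕ}
    (h : 2 * p.totalDegree < m) : p ∈ FF wt m := by
  rw [mem_FF]
  intro γ hγ
  refine lt_of_le_of_lt ?_ h
  have h1 := le_totalDegree hγ
  refine le_trans ?_ (Nat.mul_le_mul_left 2 h1)
  rw [Finsupp.weight_apply, Finsupp.sum, Finsupp.sum, Finset.mul_sum]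
  refine Finset.sum_le_sum fun i _ => ?_
  rw [smul_eq_mul, mul_comm]
  exact Nat.mul_le_mul_right _ (hw i)

end sys3
end TT


end piece_5

section piece_6

open MvPolynomial
namespace TT
set_option linter.unusedSectionVars false
set_option linter.unusedSimpArgs false
section sys4
variable {J : Type} [Fintype J] [DecidableEq J]

/-- squared norm of block -/
noncomputable def nb (J : Type) [Fintype J] (s : Bool) : MvPolynomial (Bool × Option J) ℝ := ∑ j, X (s, some j) ^ 2

/-- lower-order terms -/
noncomputable def low (e : ℝ) (p q : J → MvPolynomial (Bool × Option J) ℝ) : Bool × J → MvPolynomial (Bool × Option J) ℝ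
  | (false, i) => C e * (X (false, none) * X (false, some i) + nb J false * p i)
  | (true, i) => C e * (X (false, none) ^ 2 * X (true, some i) + nb J false * q i)

/-- degrees -/
def dg (K : ℕ) : Bool × Option J → ℕ
  | (false, some _) => 2 * K
  | (true, some _) => 2 * K + 1
  | (_, none) => 2

/-- the system -/
noncomputable def sy (e : ℝ) (p q : J → MvPolynomial (Bool × Option J) ℝ) (K : ℕ) :
    Bool × Option J → MvPolynomial (Bool × Option J) ℝ
  | (false, some i) => X (false, some i) ^ (2 * K) + low e p q (false, i)
  | (true, some i) => X (true, some i) ^ (2 * K + 1) + low e p q (true, i)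
  | (s, none) => X (s, none) ^ 2 + (nb J s - 1)

/-- weights -/
def wg : Bool × Option J → ℕ
  | (_, some _) => 1
  | (_, none) => 2

lemma wg_le (i : Bool × Option J) : wg i ≤ 2 := by
  rcases i with ⟨s, _ | j⟩ <;> simp [wg]

lemma sy_lead (e : ℝ) (p q : J → MvPolynomial (Bool × Option J) ℝ) (K : ℕ)
    (hK : ∀ i, (low e p q i).totalDegree < K) (i : Bool × Option J) :
    Lead wg (Finsupp.single i (dg K i)) (sy e p q K i) := by
  have hX : ∀ (i : Bool × Option J) d, (X i ^ d : MvPolynomial (Bool × Option J) ℝ) = monomial (Finsupp.single i d) 1 := fun i d => X_pow_eq_monomial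
  unfold Lead
  rcases i with ⟨s, _ | j⟩
  · simp only [sy, dg, hX, add_sub_cancel_left]
    rw [Finsupp.weight_single]
    have : (nb J s - 1 : MvPolynomial (Bool × Option J) ℝ) = ∑ j, monomial (Finsupp.single (s, some j) 2) 1 - monomial 0 1 := by
      simp only [nb, hX]; rfl
    rw [this]
    refine Submodule.sub_mem _ (Submodule.sum_mem _ fun j _ => monomial_mem_FF ?_) (monomial_mem_FF ?_)
    · rw [Finsupp.weight_single]; simp [wg]
    · simp [wg]
  · have h2 := hK (s, j)
    cases s
    · simp only [sy, dg, hX, add_sub_cancel_left]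
      apply FF_of_deg wg_le
      rw [Finsupp.weight_single]; simp only [wg, smul_eq_mul]; omega
    · simp only [sy, dg, hX, add_sub_cancel_left]
      apply FF_of_deg wg_le
      rw [Finsupp.weight_single]; simp only [wg, smul_eq_mul]; omega

lemma flp_X (s : Bool) (i : Bool × Option J) : flp s (X i) = if i.1 = s then -X i else X i := by
  simp [flp]

lemma flp_C (s : Bool) (c : ℝ) : flp s (C c : MvPolynomial (Bool × Option J) ℝ) = C c := by
  simp [flp]

lemma flp_nb (s t : Bool) : flp s (nb J t) = nb J t := by
  unfold nb
  rw [map_sum]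
  refine Finset.sum_congr rfl fun j _ => ?_
  rw [map_pow, flp_X]; split_ifs <;> ring

lemma sy_flp (e : ℝ) (p q : J → MvPolynomial (Bool × Option J) ℝ) (K : ℕ)
    (hp : ∀ s i, flp s (p i) = p i) (hq0 : ∀ i, flp false (q i) = q i) (hq1 : ∀ i, flp true (q i) = - q i)
    (s : Bool) (i : Bool × Option J) :
    flp s (sy e p q K i) = C (if i.1 = s then (-1 : ℝ) ^ dg K i else 1) * sy e p q K i := by
  have hev : Even (2 * K) := even_two_mul K
  have hod : Odd (2 * K + 1) := odd_two_mul_add_one K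
  rcases i with ⟨t, _ | j⟩
  · simp only [sy, dg, map_add, map_sub, flp_nb, map_pow, flp_X, map_one]
    split_ifs <;> simp
  · cases t
    · simp only [sy, dg, low, map_add, map_mul, flp_nb, map_pow, flp_X, flp_C, hp]
      cases s
      · simp [hev.neg_pow]
      · simp
    · simp only [sy, dg, low, map_add, map_mul, flp_nb, map_pow, flp_X, flp_C]
      cases s
      · simp [hq0]
      · simp [hod.neg_pow, hq1]; ring

end sys4
end TT


end piece_6

section piece_7

open MvPolynomial
namespace TT
set_option linter.unusedSectionVars false
set_option linter.unusedSimpArgs false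
section sys5
variable {J : Type} [Fintype J] [DecidableEq J]

/-- the pole -/
def x0 : Bool × Option J → ℝ
  | (_, some _) => 0
  | (_, none) => 1

lemma eval_nb (x : Bool × Option J → ℝ) (s : Bool) : eval x (nb J s) = ∑ j, x (s, some j) ^ 2 := by
  simp [nb]

lemma sy_x0 (e : ℝ) (p q : J → MvPolynomial (Bool × Option J) ℝ) (L : ℕ) (i : Bool × Option J) :
    eval x0 (sy e p q (L + 1) i) = 0 := by
  rcases i with ⟨t, _ | j⟩
  · simp [sy, eval_nb, x0]
  · cases t <;> simp [sy, low, eval_nb, x0]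

lemma sy_mem (e : ℝ) (p q : J → MvPolynomial (Bool × Option J) ℝ) (K : ℕ) (i : Bool × Option J) :
    sy e p q K i ∈ II (sy e p q K) := Ideal.subset_span ⟨i, rfl⟩

lemma sy_m2 {e : ℝ} (he : e ≠ 0) (p q : J → MvPolynomial (Bool × Option J) ℝ) (L : ℕ)
    (hp : ∀ s i, flp s (p i) = p i) (hq0 : ∀ i, flp false (q i) = q i) (hq1 : ∀ i, flp true (q i) = - q i)
 :
    ∀ (y : B0 (sy e p q (L + 1))), phiAt (sy e p q (L + 1)) x0 (sy_x0 e p q L) y = 0 →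
    y ∈ (RingHom.ker (phiAt (sy e p q (L + 1)) x0 (sy_x0 e p q L))) ^ 2 := by
  set P := sy e p q (L + 1) with hP
  set f := phiAt P x0 (sy_x0 e p q L) with hf
  have hfg : ∀ s i j, f (Phi P (gn s i j)) = x0 (s, i) * x0 (s, j) := by
    intro s i j
    rw [hf, phiAt_Phi]; simp [gn]
  have hmem : ∀ i, P i ∈ II P := sy_mem e p q (L + 1)
  have hCe : (C e⁻¹ * C e : MvPolynomial (Bool × Option J) ℝ) = 1 := by
    rw [← C_mul, inv_mul_cancel₀ he, C_1]
  let pp : J → R0 (Option J) := fun i => ⟨p i, even_mem fun s => hp s i⟩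
  let qq : J → R0 (Option J) := fun i => ⟨X (true, none) * q i, even_mem fun s => by
    rw [map_mul, flp_X]; cases s
    · simp [hq0]
    · simp [hq1]⟩
  have key := m2_abs (RingHom.ker f) (fun j k => Phi P (gn false (some j) (some k)))
    (fun j k => Phi P (gn true (some j) (some k)))
    (fun j => Phi P (gn false none (some j))) (fun j => Phi P (gn true none (some j)))
    (fun i => Phi P (pp i)) (fun i => Phi P (qq i)) (fun i => Phi P (gn false (some i) (some i) ^ L))
    (fun i => Phi P (gn true (some i) (some i) ^ L)) (Phi P (gn false none none)) (Phi P (gn true none none))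
    (Phi P (algebraMap ℝ _ e⁻¹))
    (fun j k => by rw [RingHom.mem_ker, hfg]; simp [x0]) (fun j k => by rw [RingHom.mem_ker, hfg]; simp [x0])
    (fun j => by rw [RingHom.mem_ker, hfg]; simp [x0]) (fun j => by rw [RingHom.mem_ker, hfg]; simp [x0])
    (by
      intro j k
      simp only [← map_mul, ← map_add, ← map_sum]
      apply Phi_eq
      have := Ideal.mul_mem_left (II P) (-(X (false, some j) * X (false, some k))) (hmem (false, none))
      convert this using 1
      simp only [gn, hP, sy, nb, Subalgebra.coe_add, Subalgebra.coe_mul, AddSubmonoidClass.coe_finsetSum]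
      rw [show (∑ l, X (false, some j) * X (false, some l) * (X (false, some l) * X (false, some k)) : MvPolynomial (Bool × Option J) ℝ)
        = X (false, some j) * X (false, some k) * ∑ l, X (false, some l) ^ 2 by
          rw [Finset.mul_sum]; exact Finset.sum_congr rfl fun l _ => by ring]
      ring)
    (by
      intro i
      simp only [← map_mul, ← map_add, ← map_sum, ← map_neg]
      apply Phi_eq
      have := Ideal.mul_mem_left (II P) (C e⁻¹) (hmem (false, some i))
      convert this using 1
      simp only [gn, pp, hP, sy, low, nb, Subalgebra.coe_add, Subalgebra.coe_mul, AddSubmonoidClass.coe_finsetSum, Subalgebra.coe_neg, Subalgebra.coe_pow, Subalgebra.coe_algebraMap, MvPolynomial.algebraMap_eq, ← pow_two]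
      linear_combination (-(X (false, none) * X (false, some i) + (∑ j, X (false, some j) ^ 2) * p i)) * hCe)
    (by
      rw [← map_one (Phi P)]
      simp only [← map_mul, ← map_add, ← map_sum, ← map_neg, ← map_sub]
      apply Phi_eq
      convert hmem (false, none) using 1
      simp only [gn, hP, sy, nb, Subalgebra.coe_add, Subalgebra.coe_sub, Subalgebra.coe_one, Subalgebra.coe_mul, AddSubmonoidClass.coe_finsetSum, Subalgebra.coe_neg, ← pow_two]
      ring)
    (by
      intro j k
      simp only [← map_mul, ← map_add, ← map_sum]
      apply Phi_eq
      have := Ideal.mul_mem_left (II P) (-(X (true, some j) * X (true, some k))) (hmem (true, none))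
      convert this using 1
      simp only [gn, hP, sy, nb, Subalgebra.coe_add, Subalgebra.coe_mul, AddSubmonoidClass.coe_finsetSum]
      rw [show (∑ l, X (true, some j) * X (true, some l) * (X (true, some l) * X (true, some k)) : MvPolynomial (Bool × Option J) ℝ)
        = X (true, some j) * X (true, some k) * ∑ l, X (true, some l) ^ 2 by
          rw [Finset.mul_sum]; exact Finset.sum_congr rfl fun l _ => by ring]
      ring)
    (by
      intro i
      simp only [← map_mul, ← map_add, ← map_sum, ← map_neg, ← map_sub]
      apply Phi_eq
      have h1 := Ideal.mul_mem_left (II P) (X (true, none) * C e⁻¹) (hmem (true, some i))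
      have h2 := Ideal.mul_mem_left (II P) (X (true, none) * X (true, some i)) (hmem (false, none))
      convert Ideal.sub_mem _ h1 h2 using 1
      simp only [gn, qq, hP, sy, low, nb, Subalgebra.coe_add, Subalgebra.coe_sub, Subalgebra.coe_mul, AddSubmonoidClass.coe_finsetSum, Subalgebra.coe_neg, Subalgebra.coe_pow, Subalgebra.coe_algebraMap, MvPolynomial.algebraMap_eq, ← pow_two]
      linear_combination (-X (true, none) * (X (false, none) ^ 2 * X (true, some i) + (∑ j, X (false, some j) ^ 2) * q i)) * hCe)
    (by
      rw [← map_one (Phi P)]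
      simp only [← map_mul, ← map_add, ← map_sum, ← map_neg, ← map_sub]
      apply Phi_eq
      convert hmem (true, none) using 1
      simp only [gn, hP, sy, nb, Subalgebra.coe_add, Subalgebra.coe_sub, Subalgebra.coe_one, Subalgebra.coe_mul, AddSubmonoidClass.coe_finsetSum, Subalgebra.coe_neg, ← pow_two]
      ring)
  obtain ⟨k1, k2, k3, k4, k5, k6⟩ := key
  refine m2_all f ?_
  have hsym : ∀ s (i j : Option J), gn s i j = gn s j i := by
    intro s i j
    apply Subtype.ext
    simp only [gn]
    ring
  intro s i j
  rw [hfg]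
  rcases s with _ | _ <;> rcases i with _ | i <;> rcases j with _ | j <;>
    simp only [x0, mul_zero, zero_mul, map_zero, sub_zero, mul_one, map_one]
  · exact k3
  · exact k2 j
  · rw [hsym]; exact k2 i
  · exact k1 i j
  · exact k6
  · exact k5 j
  · rw [hsym]; exact k5 i
  · exact k4 i j

theorem core [Nonempty J] {e : ℝ} (he : 0 < e) (p q : J → MvPolynomial (Bool × Option J) ℝ)
    (hp : ∀ s i, flp s (p i) = p i) (hq0 : ∀ i, flp false (q i) = q i) (hq1 : ∀ i, flp true (q i) = - q i) :
    ∃ (K : ℕ) (x : Bool × Option J → ℝ), (∃ i, x (false, some i) ≠ 0) ∧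
      (∀ i, x (false, some i) ^ (2 * K + 2) + e * (x (false, none) * x (false, some i) +
        (∑ j, x (false, some j) ^ 2) * eval x (p i)) = 0) ∧
      (∀ i, x (true, some i) ^ (2 * K + 3) + e * (x (false, none) ^ 2 * x (true, some i) +
        (∑ j, x (false, some j) ^ 2) * eval x (q i)) = 0) ∧
      (∀ s, x (s, none) ^ 2 + ∑ j, x (s, some j) ^ 2 = 1) := by
  obtain ⟨L, hL⟩ : ∃ L : ℕ, ∀ i, (low e p q i).totalDegree < L + 1 :=
    ⟨∑ i, (low e p q i).totalDegree, fun i => Nat.lt_succ_of_le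
      (Finset.single_le_sum (f := fun i => (low e p q i).totalDegree) (fun _ _ => Nat.zero_le _) (Finset.mem_univ i))⟩
  set P := sy e p q (L + 1) with hP
  have hmem : ∀ i, P i ∈ II P := sy_mem e p q (L + 1)
  have hD : ∀ i : Bool × Option J, 0 < dg (L + 1) i := by
    rintro ⟨_ | _, _ | j⟩ <;> simp [dg]
  have hfl : ∀ s i, flp s (P i) = C (if i.1 = s then (-1 : ℝ) ^ dg (L + 1) i else 1) * P i := sy_flp e p q (L + 1) hp hq0 hq1
  obtain ⟨hfin, hrk⟩ := B0_fin hD (sy_lead e p q (L + 1) hL) hfl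
  let i0 : J := Classical.arbitrary J
  have hev := Sd_even hD false (some i0) none (by simp) (even_two_mul _) (by simp [dg])
  rw [← hrk] at hev
  obtain ⟨φ, hφ⟩ := exists_other hev (phiAt P x0 (sy_x0 e p q L)) (sy_m2 he.ne' p q L hp hq0 hq1)
  obtain ⟨x, hx⟩ := real_point (φ.comp (Phi P)) (by
    intro s
    rw [← map_sum, ← map_one (φ.comp (Phi P))]
    simp only [AlgHom.comp_apply]
    congr 1
    apply Phi_eq
    convert hmem (s, none) using 1
    simp only [gn, hP, sy, nb, Subalgebra.coe_one, AddSubmonoidClass.coe_finsetSum, ← pow_two]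
    rw [Fintype.sum_option]
    ring)
  have hz : ∀ r : MvPolynomial (Bool × Option J) ℝ, (∀ s, flp s r = r) → r ∈ II P → eval x r = 0 := by
    intro r hr hI
    have h1 := hx ⟨r, even_mem hr⟩
    simp only [AlgHom.comp_apply] at h1
    rw [← h1, Phi_eq (q := 0) (by simpa using hI)]
    simp
  have hs : ∀ s, x (s, none) ^ 2 + ∑ j, x (s, some j) ^ 2 = 1 := by
    intro s
    have := hz (P (s, none)) (fun t => by rw [hfl]; split_ifs <;> simp [dg]) (hmem _)
    simp only [hP, sy, map_add, map_sub, map_pow, eval_X, eval_nb, map_one] at this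
    linarith
  have hb : ∀ i, x (false, some i) ^ (2 * L + 2) + e * (x (false, none) * x (false, some i) +
        (∑ j, x (false, some j) ^ 2) * eval x (p i)) = 0 := by
    intro i
    have := hz (P (false, some i)) (fun t => by
      rw [hfl]; simp only [dg]; rw [(even_two_mul (L + 1)).neg_one_pow]; split_ifs <;> simp) (hmem _)
    simp only [hP, sy, low, map_add, map_mul, map_pow, eval_X, eval_nb, eval_C] at this
    exact this
  have hw : ∀ i, x (true, some i) ^ (2 * L + 3) + e * (x (false, none) ^ 2 * x (true, some i) +
        (∑ j, x (false, some j) ^ 2) * eval x (q i)) = 0 := by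
    intro i
    have h1 : ∀ j, eval x (P (true, some i)) * x (true, j) = 0 := by
      intro j
      have := hz (P (true, some i) * X (true, j)) (fun t => by
        rw [map_mul, hfl, flp_X]; simp only [dg]; rw [(odd_two_mul_add_one (L + 1)).neg_one_pow]
        cases t <;> simp) (Ideal.mul_mem_right _ _ (hmem _))
      simpa using this
    have h2 : eval x (P (true, some i)) = 0 := by
      by_contra hne
      have h3 : ∀ j, x (true, j) = 0 := fun j => (mul_eq_zero.1 (h1 j)).resolve_left hne
      have := hs true
      simp [h3] at this
    simp only [hP, sy, low, map_add, map_mul, map_pow, eval_X, eval_nb, eval_C] at h2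
    exact h2
  refine ⟨L, x, ?_, hb, hw, hs⟩
  by_contra! h0
  apply hφ
  have ht : x (false, none) ^ 2 = 1 := by simpa [h0] using hs false
  have hw0 : ∀ i, x (true, some i) = 0 := by
    intro i
    have := hw i
    simp only [h0, ht] at this
    have h4 : x (true, some i) * ((x (true, some i) ^ (L + 1)) ^ 2 + e) = 0 := by
      rw [← this]; simp; ring
    refine (mul_eq_zero.1 h4).resolve_right ?_
    positivity
  have hc : x (true, none) ^ 2 = 1 := by simpa [hw0] using hs true
  apply ext_hom
  intro s i j
  have h5 := hx (gn s i j)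
  simp only [AlgHom.comp_apply] at h5
  rw [h5, phiAt_Phi]
  simp only [gn, map_mul, eval_X]
  rcases s with _ | _ <;> rcases i with _ | i <;> rcases j with _ | j <;>
    simp [x0, h0, hw0]
  · rw [← pow_two, ht]
  · rw [← pow_two, hc]
end sys5
end TT


end piece_7

section piece_8

open MvPolynomial
namespace TT
set_option linter.unusedSectionVars false
set_option linter.unusedSimpArgs false
section approx
variable {κ : Type} [Fintype κ] [DecidableEq κ]

/-- flipped point -/
def fx (s : Bool) (x : Bool × κ → ℝ) : Bool × κ → ℝ := fun i => if i.1 = s then - x i else x i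

lemma fx_fx (s : Bool) (x : Bool × κ → ℝ) : fx s (fx s x) = x := by
  ext i; simp only [fx]; split_ifs <;> simp

lemma flp_flp (s : Bool) (p : MvPolynomial (Bool × κ) ℝ) : flp s (flp s p) = p := by
  ext γ; rw [coeff_flp, coeff_flp, ← mul_assoc, ← mul_pow]; simp

lemma flp_comm (s t : Bool) (p : MvPolynomial (Bool × κ) ℝ) : flp s (flp t p) = flp t (flp s p) := by
  ext γ; simp only [coeff_flp]; ring

lemma approx0 {ι : Type} [Fintype ι] {Y : Set (ι → ℝ)} (hY : IsCompact Y) {f : (ι → ℝ) → ℝ} (hf : Continuous f)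
    {δ : ℝ} (hδ : 0 < δ) : ∃ p : MvPolynomial ι ℝ, ∀ x ∈ Y, |eval x p - f x| < δ := by
  let co : ι → C(ι → ℝ, ℝ) := fun i => ⟨fun x => x i, continuous_apply i⟩
  let A : Subalgebra ℝ C(ι → ℝ, ℝ) := (aeval co : MvPolynomial ι ℝ →ₐ[ℝ] _).range
  have hA : A.SeparatesPoints := by
    intro x y hxy
    obtain ⟨i, hi⟩ := Function.ne_iff.1 hxy
    exact ⟨co i, ⟨co i, ⟨X i, by simp⟩, rfl⟩, hi⟩
  obtain ⟨g, ⟨p, rfl⟩, hp⟩ := ContinuousMap.exists_mem_subalgebra_near_continuous_of_isCompact_of_separatesPoints hA ⟨f, hf⟩ hY hδ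
  refine ⟨p, fun x hx => ?_⟩
  have h1 : ((aeval co p : C(ι → ℝ, ℝ)) : (ι → ℝ) → ℝ) x = eval x p := by
    clear hp
    induction p using MvPolynomial.induction_on with
    | C a => simp
    | add p q hp hq => simp [hp, hq]
    | mul_X p i hp => simp [hp]; left; rfl
  have := hp x hx
  rw [← h1]
  exact this

lemma symm1 {Y : Set (Bool × κ → ℝ)} {f : (Bool × κ → ℝ) → ℝ} {δ : ℝ} {s : Bool} {σ : ℝ} (hσ : σ = 1 ∨ σ = -1)
    (hY : ∀ x ∈ Y, fx s x ∈ Y) (hf : ∀ x ∈ Y, f (fx s x) = σ * f x) {p : MvPolynomial (Bool × κ) ℝ}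
    (hp : ∀ x ∈ Y, |eval x p - f x| < δ) :
    ∃ p' : MvPolynomial (Bool × κ) ℝ, (∀ x ∈ Y, |eval x p' - f x| < δ) ∧ flp s p' = C σ * p' ∧
      ∀ t τ, flp t p = C τ * p → flp t p' = C τ * p' := by
  have hC : ∀ t (c : ℝ), flp t (C c : MvPolynomial (Bool × κ) ℝ) = C c := fun t c => by simp [flp]
  have h2 : (C σ * C σ : MvPolynomial (Bool × κ) ℝ) = 1 := by
    rw [← C_mul]; rcases hσ with rfl | rfl <;> simp
  refine ⟨C (1/2) * (p + C σ * flp s p), fun x hx => ?_, ?_, ?_⟩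
  · have e1 := hp x hx
    have e2 := hp _ (hY x hx)
    rw [hf x hx] at e2
    have e3 : eval x (flp s p) = eval (fx s x) p := eval_flp s p x
    simp only [map_mul, map_add, eval_C, e3]
    rw [abs_lt] at *
    rcases hσ with rfl | rfl
    · constructor <;> linarith
    · constructor <;> linarith
  · simp only [map_mul, map_add, hC, flp_flp]
    linear_combination (-C (1/2) * flp s p) * h2
  · intro t τ ht
    simp only [map_mul, map_add, hC, flp_comm t s, ht]
    ring

lemma approx2 {Y : Set (Bool × κ → ℝ)} (hYc : IsCompact Y) {f : (Bool × κ → ℝ) → ℝ} (hfc : Continuous f)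
    {δ : ℝ} (hδ : 0 < δ) {σ0 σ1 : ℝ} (hσ0 : σ0 = 1 ∨ σ0 = -1) (hσ1 : σ1 = 1 ∨ σ1 = -1)
    (hY : ∀ s, ∀ x ∈ Y, fx s x ∈ Y) (hf0 : ∀ x ∈ Y, f (fx false x) = σ0 * f x)
    (hf1 : ∀ x ∈ Y, f (fx true x) = σ1 * f x) :
    ∃ p : MvPolynomial (Bool × κ) ℝ, (∀ x ∈ Y, |eval x p - f x| < δ) ∧ flp false p = C σ0 * p ∧
      flp true p = C σ1 * p := by
  obtain ⟨p, hp⟩ := approx0 hYc hfc hδ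
  obtain ⟨p1, h1, h2, _⟩ := symm1 hσ0 (hY false) hf0 hp
  obtain ⟨p2, h3, h4, h5⟩ := symm1 hσ1 (hY true) hf1 h1
  exact ⟨p2, h3, h5 _ _ h2, h4⟩

end approx

section thmT
variable {J : Type} [Fintype J] [DecidableEq J]

/-- product of spheres -/
def YY (J : Type) [Fintype J] : Set (Bool × Option J → ℝ) :=
  {x | ∀ s, x (s, none) ^ 2 + ∑ j, x (s, some j) ^ 2 = 1}

lemma YY_le {x : Bool × Option J → ℝ} (hx : x ∈ YY J) (i : Bool × Option J) : |x i| ≤ 1 := by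
  rw [← sq_le_one_iff_abs_le_one]
  rcases i with ⟨s, _ | j⟩
  · have := hx s
    have h2 : 0 ≤ ∑ j, x (s, some j) ^ 2 := Finset.sum_nonneg fun _ _ => sq_nonneg _
    linarith
  · have := hx s
    have h2 : x (s, some j) ^ 2 ≤ ∑ j, x (s, some j) ^ 2 :=
      Finset.single_le_sum (f := fun j => x (s, some j) ^ 2) (fun _ _ => sq_nonneg _) (Finset.mem_univ j)
    nlinarith [sq_nonneg (x (s, none))]

lemma YY_compact : IsCompact (YY J) := by
  have h : IsCompact (Set.pi Set.univ (fun _ : Bool × Option J => Set.Icc (-1 : ℝ) 1)) :=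
    isCompact_univ_pi fun _ => isCompact_Icc
  refine h.of_isClosed_subset ?_ ?_
  · unfold YY
    simp only [Set.ofPred_forall]
    refine isClosed_iInter fun s => isClosed_eq (by fun_prop) continuous_const
  · intro x hx i _
    exact abs_le.1 (YY_le hx i)

lemma YY_fx (s : Bool) (x : Bool × Option J → ℝ) (hx : x ∈ YY J) : fx s x ∈ YY J := by
  intro t
  rw [← hx t]
  simp only [fx]
  split_ifs <;> simp

lemma approx_sol [Nonempty J] (kk hh : J → (Bool × Option J → ℝ) → ℝ) (hkc : ∀ i, Continuous (kk i))
    (hhc : ∀ i, Continuous (hh i)) (hk : ∀ s i x, kk i (fx s x) = kk i x)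
    (hh0 : ∀ i x, hh i (fx false x) = hh i x) (hh1 : ∀ i x, hh i (fx true x) = - hh i x)
    (hkt : ∀ x, ∑ i, kk i x * x (false, some i) = 0) {δ : ℝ} (hδ : 0 < δ)
    (hδ1 : (Fintype.card J + 1) * δ ≤ 1 / 2) :
    ∃ x ∈ YY J, |x (false, none)| ≤ (Fintype.card J + 1) * δ ∧
      (∀ i, |kk i x| ≤ (2 * Fintype.card J + 5) * δ) ∧ (∀ i, |hh i x| ≤ (2 * Fintype.card J + 5) * δ) := by
  have hP : ∀ i, ∃ p : MvPolynomial (Bool × Option J) ℝ, (∀ x ∈ YY J, |eval x p - kk i x| < δ) ∧ flp false p = C 1 * p ∧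
      flp true p = C 1 * p := fun i => approx2 YY_compact (hkc i) hδ (Or.inl rfl) (Or.inl rfl) YY_fx
        (fun x _ => by rw [hk, one_mul]) (fun x _ => by rw [hk, one_mul])
  have hQ : ∀ i, ∃ p : MvPolynomial (Bool × Option J) ℝ, (∀ x ∈ YY J, |eval x p - hh i x| < δ) ∧ flp false p = C 1 * p ∧
      flp true p = C (-1) * p := fun i => approx2 YY_compact (hhc i) hδ (Or.inl rfl) (Or.inr rfl) YY_fx
        (fun x _ => by rw [hh0, one_mul]) (fun x _ => by rw [hh1, neg_one_mul])
  choose p hp hp0 hp1 using hP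
  choose q hq hq0 hq1 using hQ
  obtain ⟨K, x, ⟨i0, hi0⟩, hb, hw, hx⟩ := core (e := δ⁻¹) (inv_pos.2 hδ) p q
    (fun s i => by cases s <;> simp [hp0, hp1]) (fun i => by simp [hq0]) (fun i => by simp [hq1])
  have hxY : x ∈ YY J := hx
  set r2 := ∑ j, x (false, some j) ^ 2 with hr2
  set τ := x (false, none) with hτ
  have hr : 0 < r2 := by
    have h2 : x (false, some i0) ^ 2 ≤ r2 :=
      Finset.single_le_sum (f := fun j => x (false, some j) ^ 2) (fun _ _ => sq_nonneg _) (Finset.mem_univ i0)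
    have := pow_pos (abs_pos.2 hi0) 2
    rw [sq_abs] at this
    linarith
  have hb1 : ∀ i, τ * x (false, some i) + r2 * eval x (p i) = - (δ * x (false, some i) ^ (2 * K + 2)) := by
    intro i
    have h1 := hb i
    field_simp at h1
    linarith
  have hw1 : ∀ i, τ ^ 2 * x (true, some i) + r2 * eval x (q i) = - (δ * x (true, some i) ^ (2 * K + 3)) := by
    intro i
    have h1 := hw i
    field_simp at h1
    linarith
  have hτ1 : |τ| ≤ (Fintype.card J + 1) * δ := by
    have e1 : r2 * (τ + ∑ i, (eval x (p i) - kk i x) * x (false, some i)) = - δ * ∑ i, x (false, some i) ^ (2 * K + 3) := by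
      have e2 : ∑ i, (eval x (p i) - kk i x) * x (false, some i) = ∑ i, eval x (p i) * x (false, some i) := by
        simp only [sub_mul, Finset.sum_sub_distrib, hkt, sub_zero]
      rw [e2, mul_add]
      have : r2 * τ = ∑ i, τ * x (false, some i) * x (false, some i) := by
        rw [hr2, Finset.sum_mul]; exact Finset.sum_congr rfl fun i _ => by ring
      rw [this, Finset.mul_sum, Finset.mul_sum, ← Finset.sum_add_distrib]
      refine Finset.sum_congr rfl fun i _ => ?_
      linear_combination x (false, some i) * hb1 i
    have e3 : |∑ i, x (false, some i) ^ (2 * K + 3)| ≤ r2 := by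
      refine (Finset.abs_sum_le_sum_abs _ _).trans (Finset.sum_le_sum fun i _ => ?_)
      rw [show 2 * K + 3 = 2 + (2 * K + 1) by ring, pow_add, abs_mul, abs_pow, abs_pow, sq_abs]
      have := pow_le_one₀ (n := 2 * K + 1) (abs_nonneg _) (YY_le hxY (false, some i))
      nlinarith [sq_nonneg (x (false, some i))]
    have e4 : |∑ i, (eval x (p i) - kk i x) * x (false, some i)| ≤ Fintype.card J * δ := by
      refine (Finset.abs_sum_le_sum_abs _ _).trans ?_
      have : ∀ i ∈ Finset.univ, |(eval x (p i) - kk i x) * x (false, some i)| ≤ δ := by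
        intro i _
        rw [abs_mul]
        have a1 := (hp i x hxY).le
        have a2 := YY_le hxY (false, some i)
        calc _ ≤ δ * 1 := mul_le_mul a1 a2 (abs_nonneg _) hδ.le
          _ = δ := mul_one _
      refine (Finset.sum_le_card_nsmul _ _ _ this).trans (le_of_eq ?_)
      simp
    have e5 : |τ + ∑ i, (eval x (p i) - kk i x) * x (false, some i)| ≤ δ := by
      have : r2 * |τ + ∑ i, (eval x (p i) - kk i x) * x (false, some i)| ≤ r2 * δ := by
        rw [← abs_of_pos hr, ← abs_mul, abs_of_pos hr, e1, abs_mul, abs_neg, abs_of_pos hδ, mul_comm r2]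
        exact mul_le_mul_of_nonneg_left e3 hδ.le
      exact le_of_mul_le_mul_left this hr
    have e6 := abs_sub (τ + ∑ i, (eval x (p i) - kk i x) * x (false, some i)) (∑ i, (eval x (p i) - kk i x) * x (false, some i))
    rw [add_sub_cancel_right] at e6
    linarith
  have hτ2 : τ ^ 2 ≤ |τ| / 2 := by
    rw [← sq_abs]; nlinarith [abs_nonneg τ]
  have hr34 : 3 / 4 ≤ r2 := by
    have := hx false
    linarith
  have hpow : ∀ i n, |x i ^ n| ≤ 1 := fun i n => by
    rw [abs_pow]; exact pow_le_one₀ (abs_nonneg _) (YY_le hxY i)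
  have hgen : ∀ t y u z : ℝ, |t| ≤ |τ| → |y| ≤ 1 → |u| ≤ 1 → t * y + r2 * z = - (δ * u) → |z| ≤ (2 * Fintype.card J + 4) * δ := by
    intro t y u z ht hy hu he
    have h1 : r2 * z = - (δ * u) - t * y := by linarith
    have h2 : r2 * |z| ≤ δ + |τ| := by
      rw [← abs_of_pos hr, ← abs_mul, h1]
      refine (abs_sub _ _).trans ?_
      rw [abs_neg, abs_mul, abs_mul, abs_of_pos hδ]
      have := mul_le_mul ht hy (abs_nonneg _) (abs_nonneg _)
      nlinarith
    have hc : (0:ℝ) ≤ Fintype.card J := Nat.cast_nonneg _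
    nlinarith [abs_nonneg z, mul_nonneg hc hδ.le]
  refine ⟨x, hxY, hτ1, fun i => ?_, fun i => ?_⟩
  · have h1 := hgen τ _ _ _ le_rfl (YY_le hxY _) (hpow _ _) (hb1 i)
    have h2 := (hp i x hxY).le
    have h3 := abs_sub (eval x (p i)) (eval x (p i) - kk i x)
    rw [sub_sub_cancel] at h3
    linarith
  · have h1 := hgen (τ ^ 2) _ _ _ (by rw [abs_of_nonneg (sq_nonneg _)]; linarith [abs_nonneg τ]) (YY_le hxY _) (hpow _ _) (hw1 i)
    have h2 := (hq i x hxY).le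
    have h3 := abs_sub (eval x (q i)) (eval x (q i) - hh i x)
    rw [sub_sub_cancel] at h3
    linarith

lemma exact_sol [Nonempty J] (kk hh : J → (Bool × Option J → ℝ) → ℝ) (hkc : ∀ i, Continuous (kk i))
    (hhc : ∀ i, Continuous (hh i)) (hk : ∀ s i x, kk i (fx s x) = kk i x)
    (hh0 : ∀ i x, hh i (fx false x) = hh i x) (hh1 : ∀ i x, hh i (fx true x) = - hh i x)
    (hkt : ∀ x, ∑ i, kk i x * x (false, some i) = 0) :
    ∃ x ∈ YY J, x (false, none) = 0 ∧ (∀ i, kk i x = 0) ∧ (∀ i, hh i x = 0) := by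
  have hc : (0:ℝ) ≤ Fintype.card J := Nat.cast_nonneg _
  let M : (Bool × Option J → ℝ) → ℝ := fun x => |x (false, none)| + (∑ i, |kk i x| + ∑ i, |hh i x|)
  have hM : Continuous M := by
    have h1 : ∀ i, Continuous fun x => |kk i x| := fun i => (hkc i).abs
    have h2 : ∀ i, Continuous fun x => |hh i x| := fun i => (hhc i).abs
    exact ((continuous_apply _).abs).add ((continuous_finsetSum _ fun i _ => h1 i).add (continuous_finsetSum _ fun i _ => h2 i))
  let c : ℝ := Fintype.card J
  have hs : ∀ δ : ℝ, 0 < δ → (c + 1) * δ ≤ 1 / 2 → ∃ x ∈ YY J, M x ≤ ((c + 1) + 2 * c * (2 * c + 5)) * δ := by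
    intro δ h1 h2
    obtain ⟨x, hx, a1, a2, a3⟩ := approx_sol kk hh hkc hhc hk hh0 hh1 hkt h1 h2
    refine ⟨x, hx, ?_⟩
    have b2 := Finset.sum_le_card_nsmul Finset.univ _ _ (fun i _ => a2 i)
    have b3 := Finset.sum_le_card_nsmul Finset.univ _ _ (fun i _ => a3 i)
    rw [Finset.card_univ, nsmul_eq_mul] at b2 b3
    change |x (false, none)| + _ ≤ _
    change _ ≤ (c + 1) * δ at a1
    change _ ≤ c * ((2 * c + 5) * δ) at b2
    change _ ≤ c * ((2 * c + 5) * δ) at b3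
    linarith
  have hne : (YY J).Nonempty := by
    obtain ⟨x, hx, _⟩ := hs (1 / (2 * (c + 1))) (by positivity) (by rw [one_div, mul_inv]; field_simp; exact (div_self (by positivity)).le)
    exact ⟨x, hx⟩
  obtain ⟨x, hx, hmin⟩ := YY_compact.exists_isMinOn hne hM.continuousOn
  have hCp : 0 < (c + 1) + 2 * c * (2 * c + 5) := by positivity
  have hM0 : M x ≤ 0 := by
    refine le_of_forall_pos_le_add fun η hη => ?_
    obtain ⟨y, hy, hyM⟩ := hs (min (1 / (2 * (c + 1))) (η / ((c + 1) + 2 * c * (2 * c + 5)))) (by positivity) (by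
      refine (mul_le_mul_of_nonneg_left (min_le_left _ _) (by positivity)).trans ?_
      rw [one_div, mul_inv]; field_simp; exact (div_self (by positivity)).le)
    refine (hmin hy).trans (hyM.trans ?_)
    refine (mul_le_mul_of_nonneg_left (min_le_right _ _) (by positivity)).trans ?_
    rw [mul_div_cancel₀ _ hCp.ne']; linarith
  have n1 : 0 ≤ ∑ i, |kk i x| := Finset.sum_nonneg fun _ _ => abs_nonneg _
  have n2 : 0 ≤ ∑ i, |hh i x| := Finset.sum_nonneg fun _ _ => abs_nonneg _
  have n3 := abs_nonneg (x (false, none))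
  have hM0' : |x (false, none)| + (∑ i, |kk i x| + ∑ i, |hh i x|) ≤ 0 := hM0
  have z1 : ∑ i, |kk i x| = 0 := by linarith
  have z2 : ∑ i, |hh i x| = 0 := by linarith
  have z3 : |x (false, none)| = 0 := by linarith
  rw [Finset.sum_eq_zero_iff_of_nonneg (fun _ _ => abs_nonneg _)] at z1 z2
  exact ⟨x, hx, abs_eq_zero.1 z3, fun i => abs_eq_zero.1 (z1 i (Finset.mem_univ i)), fun i => abs_eq_zero.1 (z2 i (Finset.mem_univ i))⟩

theorem thmT [Nonempty J] (k h : (J → ℝ) → (Option J → ℝ) → J → ℝ)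
    (hk : Continuous fun y : (J → ℝ) × (Option J → ℝ) => k y.1 y.2)
    (hh : Continuous fun y : (J → ℝ) × (Option J → ℝ) => h y.1 y.2)
    (hka : ∀ a z, ∑ i, a i ^ 2 = 1 → k (-a) z = k a z)
    (hkz : ∀ a z, ∑ i, a i ^ 2 = 1 → k a (-z) = k a z)
    (hha : ∀ a z, ∑ i, a i ^ 2 = 1 → h (-a) z = h a z)
    (hhz : ∀ a z, ∑ i, a i ^ 2 = 1 → h a (-z) = - h a z)
    (hkt : ∀ a z, ∑ i, a i ^ 2 = 1 → ∑ i, k a z i * a i = 0) :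
    ∃ a z, ∑ i, a i ^ 2 = 1 ∧ z none ^ 2 + ∑ i, z (some i) ^ 2 = 1 ∧ k a z = 0 ∧ h a z = 0 := by
  let B : (Bool × Option J → ℝ) → J → ℝ := fun x i => x (false, some i)
  let Z : (Bool × Option J → ℝ) → Option J → ℝ := fun x i => x (true, i)
  have hB0 : ∀ x, B (fx false x) = - B x := fun x => by ext i; simp [B, fx]
  have hB1 : ∀ x, B (fx true x) = B x := fun x => by ext i; simp [B, fx]
  have hZ0 : ∀ x, Z (fx false x) = Z x := fun x => by ext i; simp [Z, fx]
  have hZ1 : ∀ x, Z (fx true x) = - Z x := fun x => by ext i; simp [Z, fx]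
  have hBc : Continuous B := by fun_prop
  have hZc : Continuous Z := by fun_prop
  let k4 : (Bool × Option J → ℝ) → J → ℝ := fun x => (1/4 : ℝ) • (k (B x) (Z x) + k (-B x) (Z x) + k (B x) (-Z x) + k (-B x) (-Z x))
  let h4 : (Bool × Option J → ℝ) → J → ℝ := fun x => (1/4 : ℝ) • (h (B x) (Z x) + h (-B x) (Z x) - h (B x) (-Z x) - h (-B x) (-Z x))
  have hkc : ∀ u : (Bool × Option J → ℝ) → J → ℝ, ∀ v : (Bool × Option J → ℝ) → Option J → ℝ, Continuous u → Continuous v →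
    Continuous fun x => k (u x) (v x) := fun u v hu hv => hk.comp (hu.prodMk hv)
  have hhc : ∀ u : (Bool × Option J → ℝ) → J → ℝ, ∀ v : (Bool × Option J → ℝ) → Option J → ℝ, Continuous u → Continuous v →
    Continuous fun x => h (u x) (v x) := fun u v hu hv => hh.comp (hu.prodMk hv)
  have hBn : Continuous fun x => -B x := hBc.neg
  have hZn : Continuous fun x => -Z x := hZc.neg
  have hk4c : Continuous k4 := by
    have c1 := hkc _ _ hBc hZc
    have c2 := hkc _ _ hBn hZc
    have c3 := hkc _ _ hBc hZn
    have c4 := hkc _ _ hBn hZn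
    simp only [k4]
    fun_prop
  have hh4c : Continuous h4 := by
    have c1 := hhc _ _ hBc hZc
    have c2 := hhc _ _ hBn hZc
    have c3 := hhc _ _ hBc hZn
    have c4 := hhc _ _ hBn hZn
    simp only [h4]
    fun_prop
  have hk4 : ∀ s x, k4 (fx s x) = k4 x := by
    intro s x
    cases s
    · simp only [k4, hB0, hZ0, neg_neg]; congr 1; abel
    · simp only [k4, hB1, hZ1, neg_neg]; congr 1; abel
  have hh40 : ∀ x, h4 (fx false x) = h4 x := by
    intro x
    simp only [h4, hB0, hZ0, neg_neg]; congr 1; abel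
  have hh41 : ∀ x, h4 (fx true x) = - h4 x := by
    intro x
    simp only [h4, hB1, hZ1, neg_neg]; rw [← smul_neg]; congr 1; abel
  obtain ⟨x, hx, h0, h1, h2⟩ := exact_sol
    (fun i x => (∑ j, B x j ^ 2) * k4 x i - (∑ j, k4 x j * B x j) * B x i) (fun i x => h4 x i)
    (fun i => by fun_prop) (fun i => by fun_prop)
    (fun s i x => by
      simp only [hk4]
      cases s
      · simp only [hB0, Pi.neg_apply, even_two.neg_pow, mul_neg, Finset.sum_neg_distrib, neg_mul, neg_neg]
      · simp only [hB1])
    (fun i x => by rw [hh40]) (fun i x => by rw [hh41]; rfl)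
    (fun x => by
      simp only [sub_mul, Finset.sum_sub_distrib]
      have e1 : ∑ i, (∑ j, B x j ^ 2) * k4 x i * x (false, some i) = (∑ j, B x j ^ 2) * ∑ j, k4 x j * B x j := by
        rw [Finset.mul_sum]; exact Finset.sum_congr rfl fun i _ => by simp only [B]; ring
      have e2 : ∑ i, (∑ j, k4 x j * B x j) * B x i * x (false, some i) = (∑ j, k4 x j * B x j) * ∑ j, B x j ^ 2 := by
        rw [Finset.mul_sum]; exact Finset.sum_congr rfl fun i _ => by simp only [B]; ring
      rw [e1, e2]; ring)
  have hB : ∑ i, B x i ^ 2 = 1 := by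
    have := hx false
    rw [h0] at this
    simpa [B] using this
  have hB' : ∑ i, (-B x) i ^ 2 = 1 := by simpa using hB
  have q1 : k4 x = k (B x) (Z x) := by
    simp only [k4]
    rw [hka _ _ hB, hka _ _ hB, hkz _ _ hB]
    ext i; simp; ring
  have q2 : h4 x = h (B x) (Z x) := by
    simp only [h4]
    rw [hha _ _ hB, hha _ _ hB, hhz _ _ hB]
    ext i; simp; ring
  refine ⟨B x, Z x, hB, hx true, ?_, ?_⟩
  · ext i
    have := h1 i
    rw [hB, q1, hkt _ _ hB] at this
    simpa using this
  · ext i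
    have := h2 i
    rw [q2] at this
    exact this
end thmT
end TT


end piece_8

section piece_9

namespace TT
set_option linter.unusedSectionVars false
set_option linter.unusedSimpArgs false
section geo
variable {E : Type*} [NormedAddCommGroup E] [InnerProductSpace ℝ E]

/-- tangential part -/
noncomputable def tn (a w : E) : E := w - (inner ℝ w a) • a

/-- reflection -/
noncomputable def rf (a w : E) : E := w - (2 * inner ℝ w a) • a

/-- argument -/
noncomputable def zz (a w : E) (c : ℝ) : E := c • a + tn a w

/-- first map -/
noncomputable def kf (V : E) (a w : E) (c : ℝ) : E := c • (c • tn a V - (inner ℝ V a) • tn a w)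

/-- second map -/
noncomputable def hf (V : E) (a w : E) (c : ℝ) : E :=
  c • tn a V - (inner ℝ V a) • tn a w + (inner ℝ w a) • a

lemma tn_neg_left (a w : E) : tn (-a) w = tn a w := by simp [tn]
lemma tn_neg_right (a w : E) : tn a (-w) = - tn a w := by simp [tn]; abel
lemma inner_self1 {a : E} (ha : ‖a‖ = 1) : inner ℝ a a = 1 := by
  rw [real_inner_self_eq_norm_sq, ha]; norm_num
lemma tn_inner {a : E} (ha : ‖a‖ = 1) (w : E) : inner ℝ (tn a w) a = 0 := by
  rw [tn, inner_sub_left, inner_smul_left, inner_self1 ha]; simp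
lemma rf_inner {a : E} (ha : ‖a‖ = 1) (w : E) : inner ℝ (rf a w) a = - inner ℝ w a := by
  rw [rf, inner_sub_left, inner_smul_left, inner_self1 ha]; simp; ring
lemma tn_rf {a : E} (ha : ‖a‖ = 1) (w : E) : tn a (rf a w) = tn a w := by
  rw [tn, rf_inner ha, rf, tn]; module
lemma rf_add (a v w : E) : rf a (v + w) = rf a v + rf a w := by
  simp only [rf, inner_add_left]; module
lemma rf_smul (a v : E) (c : ℝ) : rf a (c • v) = c • rf a v := by
  simp only [rf, inner_smul_left]; simp; module

lemma zz_neg (a w : E) (c : ℝ) : zz a (-w) (-c) = - zz a w c := by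
  simp only [zz, tn_neg_right]; module

lemma zz_rf {a : E} (ha : ‖a‖ = 1) (w : E) (c : ℝ) : zz (-a) w c = rf a (zz a w c) := by
  have h : inner ℝ (zz a w c) a = c := by
    rw [zz, inner_add_left, tn_inner ha, inner_smul_left, inner_self1 ha]; simp
  rw [rf, h, zz, zz, tn_neg_left]; module

lemma kf_a {a : E} (ha : ‖a‖ = 1) (V w : E) (c : ℝ) : kf (rf a V) (-a) w c = kf V a w c := by
  simp only [kf, tn_neg_left, tn_rf ha, inner_neg_right, rf_inner ha, neg_neg]

lemma hf_a {a : E} (ha : ‖a‖ = 1) (V w : E) (c : ℝ) : hf (rf a V) (-a) w c = hf V a w c := by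
  simp only [hf, tn_neg_left, tn_rf ha, inner_neg_right, rf_inner ha, neg_neg, smul_neg, neg_smul]

lemma kf_z (a V w : E) (c : ℝ) : kf V a (-w) (-c) = kf V a w c := by
  simp only [kf, tn_neg_right]; module

lemma hf_z (a V w : E) (c : ℝ) : hf V a (-w) (-c) = - hf V a w c := by
  simp only [hf, tn_neg_right, inner_neg_left]; module

lemma kf_inner {a : E} (ha : ‖a‖ = 1) (V w : E) (c : ℝ) : inner ℝ (kf V a w c) a = 0 := by
  simp only [kf, inner_smul_left, inner_sub_left, tn_inner ha]; simp

lemma sol {a : E} (ha : ‖a‖ = 1) {V1 V2 w : E} {c : ℝ} (hc : c ^ 2 + ‖w‖ ^ 2 = 1) (hV : inner ℝ V1 a < 0)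
    (hk : kf V2 a w c = 0) (hh : hf V1 a w c = 0) :
    ‖zz a w c‖ = 1 ∧ tn (zz a w c) V1 = 0 ∧ tn (zz a w c) V2 = 0 := by
  have h1 : inner ℝ w a = 0 := by
    have : inner ℝ (hf V1 a w c) a = inner ℝ w a := by
      simp only [hf, inner_smul_left, inner_add_left, inner_sub_left, tn_inner ha, inner_self1 ha]; simp
    rw [← this, hh, inner_zero_left]
  have h2 : tn a w = w := by rw [tn, h1]; simp
  have hc0 : c ≠ 0 := by
    rintro rfl
    rw [hf, h1, h2] at hh
    simp only [zero_smul, zero_sub, add_zero, neg_eq_zero, smul_eq_zero] at hh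
    rcases hh with hh | hh
    · linarith
    · rw [hh] at hc; simp at hc
  have hz : ‖zz a w c‖ = 1 := by
    have : ‖zz a w c‖ ^ 2 = 1 := by
      rw [← hc, zz, h2, ← real_inner_self_eq_norm_sq, ← real_inner_self_eq_norm_sq]
      simp only [inner_add_left, inner_add_right, inner_smul_left, inner_smul_right, inner_self1 ha, h1, real_inner_comm w a]
      simp; ring
    have h0 := norm_nonneg (zz a w c)
    nlinarith
  have gen : ∀ V : E, c • tn a V - (inner ℝ V a) • tn a w = 0 → tn (zz a w c) V = 0 := by
    intro V h
    have hV : V = (c⁻¹ * inner ℝ V a) • zz a w c := by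
      rw [h2, sub_eq_zero] at h
      have e1 : tn a V = c⁻¹ • (inner ℝ V a) • w := by rw [← h, smul_smul, inv_mul_cancel₀ hc0, one_smul]
      have e2 : V = tn a V + (inner ℝ V a) • a := by rw [tn]; abel
      rw [zz, h2, smul_add, smul_smul, mul_right_comm, inv_mul_cancel₀ hc0, one_mul, mul_smul, ← e1, add_comm]
      exact e2
    rw [hV, tn, inner_smul_left, inner_self1 hz]; simp
  refine ⟨hz, gen V1 ?_, gen V2 ?_⟩
  · rw [hf, h1] at hh; simpa using hh
  · rw [kf] at hk
    exact (smul_eq_zero.1 hk).resolve_left hc0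

end geo

section thmS
variable {N : ℕ}

theorem thmS [Nonempty (Fin N)] (X1 X2 : EuclideanSpace ℝ (Fin N) → EuclideanSpace ℝ (Fin N) → EuclideanSpace ℝ (Fin N)) (c1 : Continuous fun y : EuclideanSpace ℝ (Fin N) × EuclideanSpace ℝ (Fin N) => X1 y.1 y.2)
    (c2 : Continuous fun y : EuclideanSpace ℝ (Fin N) × EuclideanSpace ℝ (Fin N) => X2 y.1 y.2)
    (r1 : ∀ a z, ‖a‖ = 1 → X1 (-a) (rf a z) = rf a (X1 a z))
    (r2 : ∀ a z, ‖a‖ = 1 → X2 (-a) (rf a z) = rf a (X2 a z))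
    (n1 : ∀ a z, ‖a‖ = 1 → X1 a (-z) = X1 a z) (n2 : ∀ a z, ‖a‖ = 1 → X2 a (-z) = X2 a z)
    (hn : ∀ a z, ‖a‖ = 1 → inner ℝ (X1 a z) a < 0) :
    ∃ a z, ‖a‖ = 1 ∧ ‖z‖ = 1 ∧ tn z (X1 a z) = 0 ∧ tn z (X2 a z) = 0 := by
  let ti : (Fin N → ℝ) → EuclideanSpace ℝ (Fin N) := fun a => WithLp.toLp 2 a
  have tc : Continuous ti := PiLp.continuous_toLp 2 _
  have oc : Continuous (fun x : EuclideanSpace ℝ (Fin N) => WithLp.ofLp x) := PiLp.continuous_ofLp 2 _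
  have tneg : ∀ a, ti (-a) = - ti a := fun a => rfl
  have tnorm : ∀ a, ∑ i, a i ^ 2 = ‖ti a‖ ^ 2 := fun a => by
    rw [EuclideanSpace.real_norm_sq_eq]
  have tn1 : ∀ a, ∑ i, a i ^ 2 = 1 → ‖ti a‖ = 1 := fun a h => by
    rw [tnorm] at h
    have h0 := norm_nonneg (ti a)
    nlinarith
  let W : (Option (Fin N) → ℝ) → EuclideanSpace ℝ (Fin N) := fun z => ti fun i => z (some i)
  have Wc : Continuous W := tc.comp (by fun_prop)
  have Wneg : ∀ z, W (-z) = - W z := fun z => rfl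
  have zzc : Continuous fun y : (Fin N → ℝ) × (Option (Fin N) → ℝ) => zz (ti y.1) (W y.2) (y.2 none) := by
    unfold zz tn; fun_prop
  have X1c : Continuous fun y : (Fin N → ℝ) × (Option (Fin N) → ℝ) => X1 (ti y.1) (zz (ti y.1) (W y.2) (y.2 none)) :=
    c1.comp ((tc.comp continuous_fst).prodMk zzc)
  have X2c : Continuous fun y : (Fin N → ℝ) × (Option (Fin N) → ℝ) => X2 (ti y.1) (zz (ti y.1) (W y.2) (y.2 none)) :=
    c2.comp ((tc.comp continuous_fst).prodMk zzc)
  obtain ⟨a, z, ha, hz, hk, hh⟩ := thmT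
    (fun a z => WithLp.ofLp (kf (X2 (ti a) (zz (ti a) (W z) (z none))) (ti a) (W z) (z none)))
    (fun a z => WithLp.ofLp (hf (X1 (ti a) (zz (ti a) (W z) (z none))) (ti a) (W z) (z none)))
    (oc.comp (by unfold kf tn; fun_prop)) (oc.comp (by unfold hf tn; fun_prop))
    (fun a z h => by
      rw [tneg, zz_rf (tn1 a h), r2 _ _ (tn1 a h), kf_a (tn1 a h)])
    (fun a z h => by
      rw [Wneg, Pi.neg_apply, zz_neg, n2 _ _ (tn1 a h), kf_z])
    (fun a z h => by
      rw [tneg, zz_rf (tn1 a h), r1 _ _ (tn1 a h), hf_a (tn1 a h)])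
    (fun a z h => by
      rw [Wneg, Pi.neg_apply, zz_neg, n1 _ _ (tn1 a h), hf_z]; rfl)
    (fun a z h => by
      have := kf_inner (tn1 a h) (X2 (ti a) (zz (ti a) (W z) (z none))) (W z) (z none)
      rw [PiLp.inner_apply] at this
      rw [← this]
      refine Finset.sum_congr rfl fun i _ => ?_
      simp [ti, mul_comm])
  have e1 : z none ^ 2 + ‖W z‖ ^ 2 = 1 := by
    rw [← hz, ← tnorm]
  obtain ⟨s1, s2, s3⟩ := sol (tn1 a ha) e1 (hn _ _ (tn1 a ha)) ((WithLp.ofLp_eq_zero 2).1 hk) ((WithLp.ofLp_eq_zero 2).1 hh)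
  exact ⟨_, _, tn1 a ha, s1, s2, s3⟩

theorem thmS2 [Nonempty (Fin N)] (X1 X2 : EuclideanSpace ℝ (Fin N) → EuclideanSpace ℝ (Fin N) → EuclideanSpace ℝ (Fin N)) (c1 : Continuous fun y : EuclideanSpace ℝ (Fin N) × EuclideanSpace ℝ (Fin N) => X1 y.1 y.2)
    (c2 : Continuous fun y : EuclideanSpace ℝ (Fin N) × EuclideanSpace ℝ (Fin N) => X2 y.1 y.2)
    (r1 : ∀ a z, ‖a‖ = 1 → X1 (-a) (rf a z) = rf a (X1 a z))
    (r2 : ∀ a z, ‖a‖ = 1 → X2 (-a) (rf a z) = rf a (X2 a z))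
    (n1 : ∀ a z, ‖a‖ = 1 → X1 a (-z) = X1 a z) (n2 : ∀ a z, ‖a‖ = 1 → X2 a (-z) = X2 a z)
    (hn : ∀ a z, ‖a‖ = 1 → inner ℝ (X1 a z) a ≤ 0) :
    ∃ a z, ‖a‖ = 1 ∧ ‖z‖ = 1 ∧ tn z (X1 a z) = 0 ∧ tn z (X2 a z) = 0 := by
  let M : EuclideanSpace ℝ (Fin N) × EuclideanSpace ℝ (Fin N) → ℝ := fun y => ‖tn y.2 (X1 y.1 y.2)‖ + ‖tn y.2 (X2 y.1 y.2)‖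
  have hM : Continuous M := by
    simp only [M]; unfold tn; fun_prop
  have hs : ∀ δ : ℝ, 0 < δ → ∃ a z : EuclideanSpace ℝ (Fin N), ‖a‖ = 1 ∧ ‖z‖ = 1 ∧ M (a, z) ≤ 2 * δ := by
    intro δ hδ
    obtain ⟨a, z, ha, hz, h1, h2⟩ := thmS (fun a z => X1 a z - δ • a) X2 (by fun_prop) c2
      (fun a z h => by
        rw [r1 a z h, sub_eq_add_neg, sub_eq_add_neg, rf_add, ← smul_neg, ← smul_neg, rf_smul]
        congr 2
        rw [rf, inner_neg_left, inner_self1 h]; module)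
      r2 (fun a z h => by rw [n1 a z h]) n2
      (fun a z h => by
        rw [inner_sub_left, inner_smul_left, inner_self1 h]
        have := hn a z h
        simp; linarith)
    refine ⟨a, z, ha, hz, ?_⟩
    have e : tn z (X1 a z) = δ • tn z a := by
      simp only [tn, inner_sub_left, inner_smul_left] at h1 ⊢
      rw [← sub_eq_zero, ← h1]; simp; module
    have e2 : ‖tn z a‖ ≤ 2 := by
      rw [tn]
      refine (norm_sub_le _ _).trans ?_
      rw [norm_smul, ha, hz, Real.norm_eq_abs]
      have := abs_real_inner_le_norm a z
      rw [ha, hz] at this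
      linarith
    simp only [M]
    rw [h2, e, norm_smul, norm_zero, Real.norm_eq_abs, abs_of_pos hδ]
    nlinarith
  have hcomp : IsCompact (Metric.sphere (0 : EuclideanSpace ℝ (Fin N)) 1 ×ˢ Metric.sphere (0 : EuclideanSpace ℝ (Fin N)) 1) :=
    (isCompact_sphere _ _).prod (isCompact_sphere _ _)
  have hmem : ∀ a z : EuclideanSpace ℝ (Fin N), (a, z) ∈ Metric.sphere (0 : EuclideanSpace ℝ (Fin N)) 1 ×ˢ Metric.sphere (0 : EuclideanSpace ℝ (Fin N)) 1 ↔ ‖a‖ = 1 ∧ ‖z‖ = 1 := by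
    intro a z; simp
  obtain ⟨⟨a, z⟩, hy, hmin⟩ := hcomp.exists_isMinOn (by
    obtain ⟨a, z, ha, hz, _⟩ := hs 1 one_pos
    exact ⟨(a, z), (hmem a z).2 ⟨ha, hz⟩⟩) hM.continuousOn
  have hM0 : M (a, z) ≤ 0 := by
    refine le_of_forall_pos_le_add fun η hη => ?_
    obtain ⟨a', z', ha, hz, h⟩ := hs (η / 2) (by positivity)
    have := hmin ((hmem a' z').2 ⟨ha, hz⟩)
    simp only [Set.mem_ofPred_eq] at this
    linarith
  have m1 := norm_nonneg (tn z (X1 a z))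
  have m2 := norm_nonneg (tn z (X2 a z))
  have hM0' : ‖tn z (X1 a z)‖ + ‖tn z (X2 a z)‖ ≤ 0 := hM0
  obtain ⟨ha, hz⟩ := (hmem a z).1 hy
  exact ⟨a, z, ha, hz, norm_eq_zero.1 (by linarith), norm_eq_zero.1 (by linarith)⟩
end thmS
end TT


end piece_9

section piece_10

namespace TT
section meas
variable {N : ℕ}

/-- folding -/
noncomputable def fd {E : Type*} [NormedAddCommGroup E] [InnerProductSpace ℝ E] (a v : E) : E :=
  v - (2 * max 0 (inner ℝ v a)) • a

/-- clamped function -/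
noncomputable def gc (g : ℝ → ℝ) (t : ℝ) : ℝ := g (max (-1) (min 1 t))

lemma gc_cont {g : ℝ → ℝ} (hg : ContinuousOn g (Set.Icc (-1) 1)) : Continuous (gc g) := by
  refine hg.comp_continuous (by fun_prop) fun t => ?_
  exact ⟨le_max_left _ _, max_le (by norm_num) (min_le_left _ _)⟩

lemma gc_bdd {g : ℝ → ℝ} (hg : ContinuousOn g (Set.Icc (-1) 1)) : ∃ C, ∀ t, |gc g t| ≤ C := by
  obtain ⟨C, hC⟩ := isCompact_Icc.exists_bound_of_continuousOn hg
  exact ⟨C, fun t => hC _ ⟨le_max_left _ _, max_le (by norm_num) (min_le_left _ _)⟩⟩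

lemma gc_even {g : ℝ → ℝ} (hg : ∀ t, g (-t) = g t) (t : ℝ) : gc g (-t) = gc g t := by
  unfold gc
  rw [← hg]
  congr 1
  rw [← min_neg_neg, ← max_neg_neg, neg_neg, neg_neg, max_min_distrib_left]
  rw [max_eq_right (by norm_num : (-1:ℝ) ≤ 1)]

lemma gc_eq {g : ℝ → ℝ} {t : ℝ} (ht : |t| ≤ 1) : gc g t = g t := by
  unfold gc
  rw [abs_le] at ht
  rw [min_eq_right ht.2, max_eq_right ht.1]

lemma gc_nonneg {g : ℝ → ℝ} (hg : ∀ t ∈ Set.Icc (-1:ℝ) 1, 0 ≤ g t) (t : ℝ) : 0 ≤ gc g t :=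
  hg _ ⟨le_max_left _ _, max_le (by norm_num) (min_le_left _ _)⟩

section ips
variable {E : Type*} [NormedAddCommGroup E] [InnerProductSpace ℝ E]

lemma fd_norm_le {a v : E} (hv : ‖v‖ = 1) : ‖fd a v‖ ≤ 1 + 2 * ‖a‖ ^ 2 := by
  unfold fd
  refine (norm_sub_le _ _).trans ?_
  rw [norm_smul, hv, Real.norm_eq_abs, abs_of_nonneg (by positivity)]
  have := abs_real_inner_le_norm v a
  rw [hv, one_mul] at this
  have h2 : max 0 (inner ℝ v a) ≤ ‖a‖ := max_le (norm_nonneg _) ((le_abs_self _).trans this)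
  nlinarith [norm_nonneg a]

lemma fd_inner {a : E} (ha : ‖a‖ = 1) (v : E) : inner ℝ (fd a v) a ≤ 0 := by
  unfold fd
  rw [inner_sub_left, inner_smul_left, inner_self1 ha]
  simp only [conj_trivial, mul_one]
  have h1 := le_max_left 0 (inner ℝ v a)
  have h2 := le_max_right 0 (inner ℝ v a)
  linarith

lemma fd_neg {a : E} (ha : ‖a‖ = 1) (v : E) : fd (-a) v = rf a (fd a v) := by
  unfold fd rf
  rw [inner_sub_left, inner_smul_left, inner_self1 ha, inner_neg_right]
  simp only [conj_trivial, mul_one]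
  have : max 0 (-inner ℝ v a) = max 0 (inner ℝ v a) - inner ℝ v a := by
    rcases le_total 0 (inner ℝ v a) with h | h
    · rw [max_eq_right h, max_eq_left (by linarith)]; ring
    · rw [max_eq_left h, max_eq_right (by linarith)]; ring
  rw [this]; module

lemma rf_rf_inner {a : E} (ha : ‖a‖ = 1) (z v : E) : inner ℝ (rf a z) (rf a v) = inner ℝ z v := by
  conv_lhs => rw [rf.eq_def a v, inner_sub_right, inner_smul_right, rf_inner ha, rf, inner_sub_left, inner_smul_left, real_inner_comm v a]
  simp; ring

lemma fd_norm {a v : E} (ha : ‖a‖ = 1) (hv : ‖v‖ = 1) : ‖fd a v‖ = 1 := by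
  have : ‖fd a v‖ ^ 2 = 1 := by
    rw [← real_inner_self_eq_norm_sq]
    unfold fd
    simp only [inner_sub_left, inner_sub_right, inner_smul_left, inner_smul_right, inner_self1 ha, inner_self1 hv, real_inner_comm v a, conj_trivial]
    rcases le_total 0 (inner ℝ v a) with h | h
    · rw [max_eq_right h]; ring
    · rw [max_eq_left h]; ring
  have h0 := norm_nonneg (fd a v)
  nlinarith

/-- reflection as a continuous linear map -/
noncomputable def rfL (a : E) : E →L[ℝ] E :=
  ContinuousLinearMap.id ℝ E - (2 : ℝ) • ((innerSL ℝ a).smulRight a)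

lemma rfL_apply (a v : E) : rfL a v = rf a v := by
  simp [rfL, rf, real_inner_comm, smul_smul]

/-- projection as a continuous linear map -/
noncomputable def tnL (a : E) : E →L[ℝ] E :=
  ContinuousLinearMap.id ℝ E - ((innerSL ℝ a).smulRight a)

lemma tnL_apply (a v : E) : tnL a v = tn a v := by
  simp [tnL, tn, real_inner_comm]
end ips

/-- integrand -/
noncomputable def Fi (g : ℝ → ℝ) (ρ : EuclideanSpace ℝ (Fin N) → ℝ) (a z v : EuclideanSpace ℝ (Fin N)) :
    EuclideanSpace ℝ (Fin N) := (ρ v * gc g (inner ℝ z (fd a v))) • fd a v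

/-- vector field -/
noncomputable def XX (g : ℝ → ℝ) (μ : MeasureTheory.Measure (EuclideanSpace ℝ (Fin N)))
    (ρ : EuclideanSpace ℝ (Fin N) → ℝ) (a z : EuclideanSpace ℝ (Fin N)) :
    EuclideanSpace ℝ (Fin N) := ∫ v, Fi g ρ a z v ∂μ

variable {g : ℝ → ℝ} {μ : MeasureTheory.Measure (EuclideanSpace ℝ (Fin N))} {ρ : EuclideanSpace ℝ (Fin N) → ℝ}

lemma Fi_meas (hg : ContinuousOn g (Set.Icc (-1) 1)) (hρ : MeasureTheory.Integrable ρ μ)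
    (a z : EuclideanSpace ℝ (Fin N)) : MeasureTheory.AEStronglyMeasurable (Fi g ρ a z) μ := by
  have h1 : Continuous fun v => fd a v := by unfold fd; fun_prop
  have h2 : Continuous fun v => gc g (inner ℝ z (fd a v)) := (gc_cont hg).comp (by fun_prop)
  exact (hρ.aestronglyMeasurable.mul h2.aestronglyMeasurable).smul h1.aestronglyMeasurable

lemma Fi_bdd {C : ℝ} (hC : ∀ t, |gc g t| ≤ C) {a z v : EuclideanSpace ℝ (Fin N)} {r : ℝ} (ha : ‖a‖ ≤ r)
    (hv : ‖v‖ = 1) : ‖Fi g ρ a z v‖ ≤ ‖ρ v‖ * (C * (1 + 2 * r ^ 2)) := by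
  unfold Fi
  rw [norm_smul, norm_mul, mul_assoc]
  refine mul_le_mul_of_nonneg_left ?_ (norm_nonneg _)
  refine mul_le_mul (hC _) ((fd_norm_le hv).trans ?_) (norm_nonneg _) ((abs_nonneg _).trans (hC 0))
  have := pow_le_pow_left₀ (norm_nonneg a) ha 2
  linarith

lemma Fi_int (hg : ContinuousOn g (Set.Icc (-1) 1)) (hρ : MeasureTheory.Integrable ρ μ)
    (hμ : ∀ᵐ v ∂μ, ‖v‖ = 1) (a z : EuclideanSpace ℝ (Fin N)) : MeasureTheory.Integrable (Fi g ρ a z) μ := by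
  obtain ⟨C, hC⟩ := gc_bdd hg
  refine MeasureTheory.Integrable.mono' (hρ.norm.mul_const (C * (1 + 2 * ‖a‖ ^ 2))) (Fi_meas hg hρ a z) ?_
  filter_upwards [hμ] with v hv
  exact Fi_bdd hC le_rfl hv

lemma XX_cont (hg : ContinuousOn g (Set.Icc (-1) 1)) (hρ : MeasureTheory.Integrable ρ μ)
    (hμ : ∀ᵐ v ∂μ, ‖v‖ = 1) :
    Continuous fun y : EuclideanSpace ℝ (Fin N) × EuclideanSpace ℝ (Fin N) => XX g μ ρ y.1 y.2 := by
  obtain ⟨C, hC⟩ := gc_bdd hg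
  rw [continuous_iff_continuousAt]
  rintro ⟨a0, z0⟩
  unfold XX
  refine MeasureTheory.continuousAt_of_dominated (bound := fun v => ‖ρ v‖ * (C * (1 + 2 * (‖a0‖ + 1) ^ 2))) ?_ ?_ ?_ ?_
  · exact Filter.Eventually.of_forall fun y => Fi_meas hg hρ _ _
  · have h1 : ∀ᶠ y : EuclideanSpace ℝ (Fin N) × EuclideanSpace ℝ (Fin N) in nhds (a0, z0), ‖y.1‖ < ‖a0‖ + 1 := by
      have : Continuous fun y : EuclideanSpace ℝ (Fin N) × EuclideanSpace ℝ (Fin N) => ‖y.1‖ := by fun_prop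
      exact this.continuousAt.eventually_lt continuousAt_const (by simp)
    filter_upwards [h1] with y hy
    filter_upwards [hμ] with v hv
    exact Fi_bdd hC hy.le hv
  · exact hρ.norm.mul_const _
  · refine Filter.Eventually.of_forall fun v => ?_
    have h1 : Continuous fun y : EuclideanSpace ℝ (Fin N) × EuclideanSpace ℝ (Fin N) => fd y.1 v := by unfold fd; fun_prop
    have h2 : Continuous fun y : EuclideanSpace ℝ (Fin N) × EuclideanSpace ℝ (Fin N) => gc g (inner ℝ y.2 (fd y.1 v)) := (gc_cont hg).comp (by fun_prop)
    unfold Fi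
    exact Continuous.continuousAt (by fun_prop)

lemma XX_rf (hg : ContinuousOn g (Set.Icc (-1) 1)) (hρ : MeasureTheory.Integrable ρ μ)
    (hμ : ∀ᵐ v ∂μ, ‖v‖ = 1) (a z : EuclideanSpace ℝ (Fin N)) (ha : ‖a‖ = 1) :
    XX g μ ρ (-a) (rf a z) = rf a (XX g μ ρ a z) := by
  unfold XX
  rw [← rfL_apply a (∫ v, Fi g ρ a z v ∂μ), ← ContinuousLinearMap.integral_comp_comm _ (Fi_int hg hρ hμ a z)]
  congr 1
  ext1 v
  rw [rfL_apply, Fi, Fi, rf_smul, fd_neg ha, rf_rf_inner ha]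

lemma XX_neg (hg : ∀ t, g (-t) = g t) (a z : EuclideanSpace ℝ (Fin N)) :
    XX g μ ρ a (-z) = XX g μ ρ a z := by
  unfold XX Fi
  simp only [inner_neg_left, gc_even hg]

lemma XX_inner (hg : ContinuousOn g (Set.Icc (-1) 1)) (hρ : MeasureTheory.Integrable ρ μ)
    (hμ : ∀ᵐ v ∂μ, ‖v‖ = 1) (hg0 : ∀ t ∈ Set.Icc (-1:ℝ) 1, 0 ≤ g t) (hρ0 : ∀ᵐ v ∂μ, 0 ≤ ρ v)
    (a z : EuclideanSpace ℝ (Fin N)) (ha : ‖a‖ = 1) :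
    inner ℝ (XX g μ ρ a z) a ≤ 0 := by
  unfold XX
  rw [real_inner_comm, ← integral_inner (Fi_int hg hρ hμ a z)]
  refine MeasureTheory.integral_nonpos_of_ae ?_
  filter_upwards [hρ0] with v hv
  rw [Fi, inner_smul_right, real_inner_comm (fd a v) a]
  exact mul_nonpos_of_nonneg_of_nonpos (mul_nonneg hv (gc_nonneg hg0 _)) (fd_inner ha v)

lemma XX_tn (hg : ContinuousOn g (Set.Icc (-1) 1)) (hρ : MeasureTheory.Integrable ρ μ)
    (hμ : ∀ᵐ v ∂μ, ‖v‖ = 1) (a z : EuclideanSpace ℝ (Fin N)) (ha : ‖a‖ = 1) (hz : ‖z‖ = 1) :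
    ∫ v, (ρ v * g (inner ℝ z (fd a v))) • tn z (fd a v) ∂μ = tn z (XX g μ ρ a z) := by
  unfold XX
  rw [← tnL_apply, ← ContinuousLinearMap.integral_comp_comm _ (Fi_int hg hρ hμ a z)]
  refine MeasureTheory.integral_congr_ae ?_
  filter_upwards [hμ] with v hv
  rw [Fi, map_smul, tnL_apply, gc_eq]
  have := abs_real_inner_le_norm z (fd a v)
  rwa [hz, fd_norm ha hv, one_mul] at this

theorem final [Nonempty (Fin N)] {σ : EuclideanSpace ℝ (Fin N) → ℝ} (hg : ContinuousOn g (Set.Icc (-1) 1))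
    (hge : ∀ t, g (-t) = g t) (hg0 : ∀ t ∈ Set.Icc (-1:ℝ) 1, 0 ≤ g t) (hμ : ∀ᵐ v ∂μ, ‖v‖ = 1)
    (hρ : MeasureTheory.Integrable ρ μ) (hσ : MeasureTheory.Integrable σ μ) (hρ0 : ∀ᵐ v ∂μ, 0 ≤ ρ v) :
    ∃ a z, ‖a‖ = 1 ∧ ‖z‖ = 1 ∧ ∫ v, (ρ v * g (inner ℝ z (fd a v))) • tn z (fd a v) ∂μ = 0 ∧
      ∫ v, (σ v * g (inner ℝ z (fd a v))) • tn z (fd a v) ∂μ = 0 := by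
  obtain ⟨a, z, ha, hz, h1, h2⟩ := thmS2 (XX g μ ρ) (XX g μ σ) (XX_cont hg hρ hμ) (XX_cont hg hσ hμ)
    (XX_rf hg hρ hμ) (XX_rf hg hσ hμ) (fun a z _ => XX_neg hge a z) (fun a z _ => XX_neg hge a z)
    (XX_inner hg hρ hμ hg0 hρ0)
  exact ⟨a, z, ha, hz, by rw [XX_tn hg hρ hμ a z ha hz, h1], by rw [XX_tn hg hσ hμ a z ha hz, h2]⟩
end meas
end TT


end piece_10

/-- For `ρ, σ ∈ L¹(Sⁿ)` with `ρ ≥ 0` a.e., there exist `a, z ∈ Sⁿ` such that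
`z` is a critical point of both `z ↦ ∫ ρ(v) G(z·F_a v) dv` and `z ↦ ∫ σ(v) G(z·F_a v) dv`,
i.e. both vector-valued integrals `∫ ρ(v) g(z·F_a v) π_z(F_a v) dv` and
`∫ σ(v) g(z·F_a v) π_z(F_a v) dv` vanish. -/
theorem statement0 (n : ℕ) (hn : 2 ≤ n)
    (g : ℝ → ℝ) (hg_cont : ContinuousOn g (Set.Icc (-1) 1))
    (hg_even : ∀ t, g (-t) = g t)
    (hg_nonneg : ∀ t ∈ Set.Icc (-1:ℝ) 1, 0 ≤ g t)
    (hg_pos : ∀ t ∈ Set.Ioo (-1:ℝ) 1, 0 < g t)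
    (ρ σ : EuclideanSpace ℝ (Fin (n + 1)) → ℝ)
    (hρ : Integrable ρ ((μH[(n:ℝ)]).restrict (sph n)))
    (hσ : Integrable σ ((μH[(n:ℝ)]).restrict (sph n)))
    (hρ0 : ∀ᵐ v ∂(μH[(n:ℝ)]).restrict (sph n), 0 ≤ ρ v) :
    ∃ a ∈ sph n, ∃ z ∈ sph n,
      (∫ v in sph n, (ρ v * g ⟪z, fold n a v⟫) • proj n z (fold n a v) ∂μH[(n:ℝ)]) = 0 ∧
      (∫ v in sph n, (σ v * g ⟪z, fold n a v⟫) • proj n z (fold n a v) ∂μH[(n:ℝ)]) = 0 := by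
  have hsm : MeasurableSet (sph n) := Metric.isClosed_sphere.measurableSet
  have hμ : ∀ᵐ v ∂(μH[(n:ℝ)]).restrict (sph n), ‖v‖ = 1 := by
    filter_upwards [ae_restrict_mem hsm] with v hv
    simpa [sph] using hv
  have hfold : ∀ a v, fold n a v = TT.fd a v := by
    intro a v
    unfold fold TT.fd sphRefl
    split_ifs with h
    · rw [max_eq_right h.le]
    · rw [max_eq_left (not_lt.1 h)]; simp
  obtain ⟨a, z, ha, hz, h1, h2⟩ := TT.final hg_cont hg_even hg_nonneg hμ hρ hσ hρ0
  refine ⟨a, by simpa [sph] using ha, z, by simpa [sph] using hz, ?_, ?_⟩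
  · simp only [hfold]
    exact h1
  · simp only [hfold]
    exact h2
end
end

section
/- Let n ≥ 2, p ∈ Sⁿ, r ∈ (0, π/2), and let z ∈ Sⁿ with z ≠ p and z ≠ −p. Let u = −π_z(p)/|π_z(p)| be the unique unit vector in the tangent space z^⊥ lying in the plane spanned by p and z with u·p < 0. Then ∫_{B_{p,r}} g(z·v) (u·v) dv < 0. -/
open MeasureTheory Real
open scoped RealInnerProductSpace

noncomputable section

theorem aux_orth_mem (n : ℕ) (p v : EuclideanSpace ℝ (Fin (n + 1))) (hp : ‖p‖ = 1) :
    v - ⟪p, v⟫ • p ∈ (Submodule.span ℝ {p})ᗮ := by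
  rw [Submodule.mem_orthogonal_singleton_iff_inner_right, inner_sub_right, inner_smul_right,
    real_inner_self_eq_norm_sq, hp]
  ring

theorem aux_finrank (n : ℕ) (p : EuclideanSpace ℝ (Fin (n + 1))) (hp : ‖p‖ = 1) :
    Module.finrank ℝ (Submodule.span ℝ {p})ᗮ = n := by
  have : Fact (Module.finrank ℝ (EuclideanSpace ℝ (Fin (n + 1))) = n + 1) := ⟨by simp⟩
  apply Submodule.finrank_orthogonal_span_singleton
  intro h
  simp [h] at hp

theorem aux_haar (n : ℕ) (p : EuclideanSpace ℝ (Fin (n + 1))) (hp : ‖p‖ = 1) :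
    Measure.IsAddHaarMeasure (μH[(n:ℝ)] : Measure (Submodule.span ℝ {p})ᗮ) := by
  have := MeasureTheory.isAddHaarMeasure_hausdorffMeasure (E := (Submodule.span ℝ {p})ᗮ)
  rwa [aux_finrank n p hp] at this

theorem aux_norm (n : ℕ) (p w : EuclideanSpace ℝ (Fin (n + 1))) (hp : ‖p‖ = 1)
    (hw : ⟪p, w⟫ = 0) (t : ℝ) : ‖w + t • p‖ ^ 2 = ‖w‖ ^ 2 + t ^ 2 := by
  rw [norm_add_sq_real, inner_smul_right, real_inner_comm, hw, norm_smul, hp]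
  simp

theorem aux_pos (n : ℕ) (p : EuclideanSpace ℝ (Fin (n + 1))) (hp : ‖p‖ = 1)
    (U : Set (EuclideanSpace ℝ (Fin (n + 1)))) (hU : IsOpen U) (hpU : p ∈ U) :
    0 < μH[(n:ℝ)] (U ∩ sph n) := by
  have := aux_haar n p hp
  let K := (Submodule.span ℝ {p})ᗮ
  let ψ : K → EuclideanSpace ℝ (Fin (n + 1)) := fun w => (w : EuclideanSpace ℝ (Fin (n + 1))) + √(1 - ‖w‖ ^ 2) • p
  have hψ : Continuous ψ := by fun_prop
  let V : Set K := ψ ⁻¹' U ∩ Metric.ball 0 1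
  have hV : IsOpen V := (hU.preimage hψ).inter Metric.isOpen_ball
  have h0 : (0 : K) ∈ V := by
    refine ⟨?_, by simp⟩
    simpa [ψ] using hpU
  have hVpos : 0 < μH[(n:ℝ)] V := hV.measure_pos _ ⟨0, h0⟩
  have hL : LipschitzWith 1 (K.orthogonalProjectionOnto) := by
    refine LipschitzWith.of_dist_le_mul fun x y => ?_
    rw [dist_eq_norm, dist_eq_norm, ← map_sub]
    simpa using K.norm_orthogonalProjectionOnto_apply_le (x - y)
  have hsub : V ⊆ K.orthogonalProjectionOnto '' (U ∩ sph n) := by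
    intro w hw
    have hwb : ‖w‖ < 1 := by simpa using hw.2
    have hwp : ⟪p, (w : EuclideanSpace ℝ (Fin (n + 1)))⟫ = 0 :=
      Submodule.mem_orthogonal_singleton_iff_inner_right.1 w.2
    refine ⟨ψ w, ⟨hw.1, ?_⟩, ?_⟩
    · have h1 := aux_norm n p w hp hwp (√(1 - ‖w‖ ^ 2))
      rw [Real.sq_sqrt (by nlinarith [norm_nonneg w]), Submodule.coe_norm] at h1
      have h2 : ‖ψ w‖ ^ 2 = 1 := by simp only [ψ]; rw [Submodule.coe_norm, h1]; ring
      have h3 : ‖ψ w‖ = 1 := by nlinarith [norm_nonneg (ψ w)]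
      simpa [sph] using h3
    · simp only [ψ, map_add, map_smul]
      have : K.orthogonalProjectionOnto p = 0 := by
        rw [Submodule.orthogonalProjectionOnto_eq_zero_iff]
        exact Submodule.le_orthogonal_orthogonal _ (Submodule.mem_span_singleton_self p)
      rw [this]; simp
  have h4 := hL.hausdorffMeasure_image_le (d := n) (by positivity) (U ∩ sph n)
  have h5 := measure_mono (μ := μH[(n:ℝ)]) hsub
  refine lt_of_lt_of_le hVpos (h5.trans (h4.trans ?_))
  simp

theorem aux_fin (n : ℕ) (p : EuclideanSpace ℝ (Fin (n + 1))) (hp : ‖p‖ = 1)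
    (c : ℝ) (hc : 0 < c) :
    μH[(n:ℝ)] {v | v ∈ sph n ∧ c < ⟪p, v⟫} < ⊤ := by
  have := aux_haar n p hp
  let K := (Submodule.span ℝ {p})ᗮ
  let ψ : K → EuclideanSpace ℝ (Fin (n + 1)) := fun w => (w : EuclideanSpace ℝ (Fin (n + 1))) + √(1 - ‖w‖ ^ 2) • p
  let T : Set K := {w | ‖w‖ ≤ 1 ∧ c ≤ √(1 - ‖w‖ ^ 2)}
  have hT : μH[(n:ℝ)] T < ⊤ := by
    refine lt_of_le_of_lt (measure_mono (t := Metric.closedBall 0 1) ?_)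
      (isCompact_closedBall (0 : K) 1).measure_lt_top
    intro w hw
    simpa using hw.1
  have hL : LipschitzOnWith (1 + 1 / c).toNNReal ψ T := by
    refine LipschitzOnWith.of_dist_le_mul fun x hx y hy => ?_
    rw [Real.coe_toNNReal _ (by positivity), dist_eq_norm, dist_eq_norm]
    have e : ψ x - ψ y = ((x - y : K) : EuclideanSpace ℝ (Fin (n + 1)))
        + (√(1 - ‖x‖ ^ 2) - √(1 - ‖y‖ ^ 2)) • p := by
      simp only [ψ, Submodule.coe_sub]; module
    rw [e]
    refine (norm_add_le _ _).trans ?_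
    rw [norm_smul, hp, mul_one, Real.norm_eq_abs, add_mul, one_mul]
    refine add_le_add (le_of_eq rfl) ?_
    have hx1 := Real.sq_sqrt (show 0 ≤ 1 - ‖x‖ ^ 2 by nlinarith [norm_nonneg x, hx.1])
    have hy1 := Real.sq_sqrt (show 0 ≤ 1 - ‖y‖ ^ 2 by nlinarith [norm_nonneg y, hy.1])
    have hx2 := hx.2
    have hy2 := hy.2
    have hx3 := hx.1
    have hy3 := hy.1
    set a := √(1 - ‖x‖ ^ 2)
    set b := √(1 - ‖y‖ ^ 2)
    have h1 : |‖y‖ - ‖x‖| ≤ ‖x - y‖ := by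
      rw [norm_sub_rev]; exact abs_norm_sub_norm_le y x
    have h2 : |a - b| * (a + b) = |‖y‖ - ‖x‖| * (‖y‖ + ‖x‖) := by
      have e1 : |(a - b) * (a + b)| = |a - b| * (a + b) := by
        rw [abs_mul, abs_of_nonneg (show 0 ≤ a + b by linarith)]
      have e2 : |(‖y‖ - ‖x‖) * (‖y‖ + ‖x‖)| = |‖y‖ - ‖x‖| * (‖y‖ + ‖x‖) := by
        rw [abs_mul, abs_of_nonneg (show 0 ≤ ‖y‖ + ‖x‖ by positivity)]
      rw [← e1, ← e2]
      congr 1; linarith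
    have h3 : |a - b| * (2 * c) ≤ ‖x - y‖ * 2 := by
      calc |a - b| * (2 * c) ≤ |a - b| * (a + b) := by gcongr; linarith
        _ = |‖y‖ - ‖x‖| * (‖y‖ + ‖x‖) := h2
        _ ≤ ‖x - y‖ * 2 := by gcongr; linarith
    rw [one_div, inv_mul_eq_div, le_div_iff₀ hc]
    linarith
  have hsub : {v | v ∈ sph n ∧ c < ⟪p, v⟫} ⊆ ψ '' T := by
    rintro v ⟨hv, hcv⟩
    have hv1 : ‖v‖ = 1 := by simpa [sph] using hv
    let w : K := ⟨v - ⟪p, v⟫ • p, aux_orth_mem n p v hp⟩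
    have hwp : ⟪p, v - ⟪p, v⟫ • p⟫ = 0 :=
      Submodule.mem_orthogonal_singleton_iff_inner_right.1 w.2
    have h1 := aux_norm n p _ hp hwp ⟪p, v⟫
    rw [sub_add_cancel, hv1] at h1
    have h2 : ‖w‖ ^ 2 = 1 - ⟪p, v⟫ ^ 2 := by
      rw [Submodule.coe_norm]; simp only [w]; linarith
    have h3 : √(1 - ‖w‖ ^ 2) = ⟪p, v⟫ := by
      rw [h2, sub_sub_cancel, Real.sqrt_sq (by linarith)]
    refine ⟨w, ⟨?_, ?_⟩, ?_⟩
    · nlinarith [norm_nonneg w, sq_nonneg ⟪p, v⟫]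
    · rw [h3]; exact hcv.le
    · simp only [ψ, h3, w]; simp
  refine lt_of_le_of_lt (measure_mono hsub) ?_
  refine lt_of_le_of_lt (hL.hausdorffMeasure_image_le (by positivity)) ?_
  exact ENNReal.mul_lt_top (ENNReal.rpow_lt_top_of_nonneg (by positivity) ENNReal.coe_ne_top) hT


theorem aux_gball (n : ℕ) (p : EuclideanSpace ℝ (Fin (n + 1))) (hp : ‖p‖ = 1)
    (r : ℝ) (hr : r ∈ Set.Ioo 0 (π / 2)) :
    gball n p r = {v | v ∈ sph n ∧ cos r < ⟪p, v⟫} := by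
  ext v
  simp only [gball, Set.mem_ofPred_eq]
  refine and_congr_right fun hv => ?_
  have hv1 : ‖v‖ = 1 := by simpa [sph] using hv
  have h := abs_real_inner_le_norm p v
  rw [hp, hv1, mul_one, abs_le] at h
  have hr' : r = arccos (cos r) := (arccos_cos hr.1.le (by linarith [hr.2, pi_pos])).symm
  conv_lhs => rw [hr']
  exact strictAntiOn_arccos.lt_iff_gt ⟨h.1, h.2⟩ ⟨neg_one_le_cos r, cos_le_one r⟩

theorem aux_exists (n : ℕ) (hn : 2 ≤ n) (p u : EuclideanSpace ℝ (Fin (n + 1))) :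
    ∃ e : EuclideanSpace ℝ (Fin (n + 1)), ‖e‖ = 1 ∧ ⟪p, e⟫ = 0 ∧ ⟪u, e⟫ = 0 := by
  let S := Submodule.span ℝ ((({p, u} : Finset (EuclideanSpace ℝ (Fin (n + 1)))) : Set (EuclideanSpace ℝ (Fin (n + 1)))))
  have h1 : Module.finrank ℝ S ≤ 2 := by
    classical
    exact (finrank_span_finset_le_card _).trans Finset.card_le_two
  have h2 := S.finrank_add_finrank_orthogonal
  have h3 : Module.finrank ℝ (EuclideanSpace ℝ (Fin (n + 1))) = n + 1 := by simp
  have h4 : 0 < Module.finrank ℝ Sᗮ := by omega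
  have := Module.finrank_pos_iff.1 h4
  obtain ⟨x, hx⟩ := exists_ne (0 : Sᗮ)
  have hx0 : (x : EuclideanSpace ℝ (Fin (n + 1))) ≠ 0 := by simpa using hx
  refine ⟨‖(x : EuclideanSpace ℝ (Fin (n + 1)))‖⁻¹ • x, ?_, ?_, ?_⟩
  · rw [norm_smul, norm_inv, norm_norm, inv_mul_cancel₀ (norm_ne_zero_iff.2 hx0)]
  · rw [inner_smul_right, (Submodule.mem_orthogonal _ _).1 x.2 p (Submodule.subset_span (by simp))]
    simp
  · rw [inner_smul_right, (Submodule.mem_orthogonal _ _).1 x.2 u (Submodule.subset_span (by simp))]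
    simp

theorem aux_main (n : ℕ) (hn : 2 ≤ n)
    (g : ℝ → ℝ) (hg_cont : ContinuousOn g (Set.Icc (-1) 1))
    (hg_nonneg : ∀ t ∈ Set.Icc (-1:ℝ) 1, 0 ≤ g t)
    (hg_pos : ∀ t ∈ Set.Ioo (-1:ℝ) 1, 0 < g t)
    (p z u : EuclideanSpace ℝ (Fin (n + 1))) (hp : ‖p‖ = 1) (hz : ‖z‖ = 1) (hu : ‖u‖ = 1)
    (hzu : ⟪z, u⟫ = 0) (hpu : ⟪p, u⟫ < 0) (c : ℝ) (hc : 0 < c) (hc1 : c < 1) :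
    (∫ v in {v | v ∈ sph n ∧ c < ⟪p, v⟫}, g ⟪z, v⟫ * ⟪u, v⟫ ∂μH[(n:ℝ)]) < 0 := by
  set B : Set (EuclideanSpace ℝ (Fin (n + 1))) := {v | v ∈ sph n ∧ c < ⟪p, v⟫} with hB
  set f : EuclideanSpace ℝ (Fin (n + 1)) → ℝ := fun v => g ⟪z, v⟫ * ⟪u, v⟫ with hf
  have hsphm : MeasurableSet (sph n) := Metric.isClosed_sphere.measurableSet
  have hop : ∀ (a : EuclideanSpace ℝ (Fin (n + 1))) (b : ℝ), MeasurableSet {v | b < ⟪a, v⟫} :=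
    fun a b => (isOpen_lt continuous_const (continuous_const.inner continuous_id)).measurableSet
  have hBm : MeasurableSet B := hsphm.inter (hop p c)
  have hBfin : μH[(n:ℝ)] B < ⊤ := aux_fin n p hp c hc
  have hnorm : ∀ v ∈ sph n, ‖v‖ = 1 := fun v hv => by simpa [sph] using hv
  have hzv : ∀ v ∈ sph n, ⟪z, v⟫ ∈ Set.Icc (-1:ℝ) 1 := fun v hv => by
    have h := abs_real_inner_le_norm z v
    rw [hz, hnorm v hv, mul_one, abs_le] at h
    exact ⟨h.1, h.2⟩
  have hbes : ∀ v ∈ sph n, ⟪z, v⟫ ^ 2 + ⟪u, v⟫ ^ 2 ≤ 1 := fun v hv => by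
    have h := real_inner_self_nonneg (x := v - ⟪z, v⟫ • z - ⟪u, v⟫ • u)
    simp only [inner_sub_left, inner_sub_right, inner_smul_left, inner_smul_right,
      real_inner_self_eq_norm_sq, hz, hu, hnorm v hv, real_inner_comm z u, hzu,
      real_inner_comm z v, real_inner_comm u v] at h
    rw [real_inner_comm] at hzu
    simp only [hzu, real_inner_comm v z, real_inner_comm v u] at h
    simp at h
    rw [real_inner_comm v z, real_inner_comm v u]
    nlinarith
  have hfc : ContinuousOn f (sph n) := by
    refine ContinuousOn.mul (hg_cont.comp (by fun_prop) hzv) (by fun_prop)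
  obtain ⟨M, hM⟩ := (isCompact_sphere (0 : EuclideanSpace ℝ (Fin (n + 1))) 1).exists_bound_of_continuousOn hfc
  have hBs : B ⊆ sph n := fun v hv => hv.1
  have hfi : IntegrableOn f B μH[(n:ℝ)] := by
    refine ⟨(hfc.mono hBs).aestronglyMeasurable hBm, .restrict_of_bounded (C := M) hBfin ?_⟩
    filter_upwards [ae_restrict_mem hBm] with v hv using hM v (hBs hv)
  let R := ((Submodule.span ℝ {u})ᗮ).reflection
  have hR : ∀ v, R v = v - (2 * ⟪u, v⟫) • u := fun v => by
    simp only [R]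
    rw [Submodule.reflection_orthogonal_apply, Submodule.reflection_singleton_apply, hu]
    simp
    module
  have hRn : ∀ v, R v ∈ sph n ↔ v ∈ sph n := fun v => by simp [sph]
  have hRz : ∀ v, ⟪z, R v⟫ = ⟪z, v⟫ := fun v => by
    rw [hR, inner_sub_right, inner_smul_right, hzu]; ring
  have hRu : ∀ v, ⟪u, R v⟫ = -⟪u, v⟫ := fun v => by
    rw [hR, inner_sub_right, inner_smul_right, real_inner_self_eq_norm_sq, hu]; ring
  have hRp : ∀ v, ⟪p, R v⟫ = ⟪p, v⟫ - 2 * ⟪u, v⟫ * ⟪p, u⟫ := fun v => by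
    rw [hR, inner_sub_right, inner_smul_right]
  have hRR : ∀ v, R (R v) = v := fun v => by simp [R]
  have hfR : ∀ v, f (R v) = - f v := fun v => by simp only [f, hRz, hRu]; ring
  have hmp : MeasurePreserving R μH[(n:ℝ)] μH[(n:ℝ)] :=
    R.toIsometryEquiv.measurePreserving_hausdorffMeasure _
  have hme : MeasurableEmbedding R := R.toHomeomorph.measurableEmbedding
  let A : Set (EuclideanSpace ℝ (Fin (n + 1))) := B ∩ {v | 0 < ⟪u, v⟫}
  let A' : Set (EuclideanSpace ℝ (Fin (n + 1))) := R ⁻¹' A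
  have hAm : MeasurableSet A :=
    hBm.inter (hop u 0)
  have hA'm : MeasurableSet A' := hme.measurable hAm
  have hA'B : A' ⊆ B \ A := by
    rintro v ⟨⟨h1, h2⟩, h3⟩
    simp only [Set.mem_ofPred_eq, hRu] at h3
    rw [hRp] at h2
    refine ⟨⟨(hRn v).1 h1, ?_⟩, fun h => ?_⟩
    · have := mul_pos_of_neg_of_neg (show ⟪u, v⟫ < 0 by linarith) hpu
      linarith
    · have : 0 < ⟪u, v⟫ := h.2
      linarith
  have hAA : ∫ v in A', f v ∂μH[(n:ℝ)] = - ∫ v in A, f v ∂μH[(n:ℝ)] := by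
    rw [← hmp.setIntegral_preimage_emb hme f A, ← integral_neg]
    simp only [hfR, neg_neg, A']
  let D := (B \ A) \ A'
  have hDm : MeasurableSet D := (hBm.diff hAm).diff hA'm
  have hDB : D ⊆ B := fun v hv => hv.1.1
  have hI : ∫ v in B, f v ∂μH[(n:ℝ)] = ∫ v in D, f v ∂μH[(n:ℝ)] := by
    have h1 := setIntegral_sdiff hAm hfi (Set.inter_subset_left : A ⊆ B)
    have h2 := setIntegral_sdiff hA'm (hfi.mono_set Set.sdiff_subset) hA'B
    simp only [D]
    rw [h2, h1, hAA]; ring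
  rw [hI, ← neg_pos, ← integral_neg]
  rw [setIntegral_pos_iff_support_of_nonneg_ae]
  · let U : Set (EuclideanSpace ℝ (Fin (n + 1))) := {v | ⟪u, v⟫ < 0 ∧ c < ⟪p, v⟫ ∧ ⟪p, R v⟫ < c}
    have hU : IsOpen U := by
      have o1 : IsOpen {v : EuclideanSpace ℝ (Fin (n + 1)) | ⟪u, v⟫ < 0} :=
        isOpen_lt (continuous_const.inner continuous_id) continuous_const
      have o2 : IsOpen {v : EuclideanSpace ℝ (Fin (n + 1)) | c < ⟪p, v⟫} :=
        isOpen_lt continuous_const (continuous_const.inner continuous_id)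
      have o3 : IsOpen {v : EuclideanSpace ℝ (Fin (n + 1)) | ⟪p, R v⟫ < c} :=
        isOpen_lt (continuous_const.inner R.continuous) continuous_const
      exact o1.inter (o2.inter o3)
    obtain ⟨e, he, hpe, hue⟩ := aux_exists n hn p u
    obtain ⟨x, hx1, hx2, hx3⟩ : ∃ x : ℝ, c < x ∧ x < 1 ∧ x * (1 - 2 * ⟪p, u⟫ ^ 2) < c := by
      set s := ⟪p, u⟫
      have h1 : 0 < s ^ 2 := sq_pos_of_neg hpu
      refine ⟨min ((c + 1) / 2) (c * (1 + s ^ 2)), ?_, ?_, ?_⟩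
      · exact lt_min (by linarith) (by nlinarith)
      · exact lt_of_le_of_lt (min_le_left _ _) (by linarith)
      · have hm : 0 < min ((c + 1) / 2) (c * (1 + s ^ 2)) := lt_min (by linarith) (by positivity)
        have hm2 := min_le_right ((c + 1) / 2) (c * (1 + s ^ 2))
        set m := min ((c + 1) / 2) (c * (1 + s ^ 2))
        by_cases h : 0 ≤ 1 - 2 * s ^ 2
        · have : m * (1 - 2 * s ^ 2) ≤ c * (1 + s ^ 2) * (1 - 2 * s ^ 2) := by gcongr
          nlinarith [mul_pos hc h1, mul_pos (mul_pos hc h1) h1]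
        · nlinarith
    have hup : ⟪u, p⟫ = ⟪p, u⟫ := real_inner_comm _ _
    let v0 := √(1 - x ^ 2) • e + x • p
    have hv0 : ‖v0‖ = 1 := by
      have h := aux_norm n p (√(1 - x ^ 2) • e) hp (by rw [inner_smul_right, hpe, mul_zero]) x
      rw [norm_smul, he, mul_one, Real.norm_eq_abs, sq_abs, Real.sq_sqrt (by nlinarith)] at h
      have : ‖v0‖ ^ 2 = 1 := by simp only [v0]; rw [h]; ring
      nlinarith [norm_nonneg v0]
    have huv0 : ⟪u, v0⟫ = x * ⟪p, u⟫ := by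
      simp only [v0, inner_add_right, inner_smul_right, hue, hup]; ring
    have hpv0 : ⟪p, v0⟫ = x := by
      simp only [v0, inner_add_right, inner_smul_right, hpe, real_inner_self_eq_norm_sq, hp]; ring
    have hv0U : v0 ∈ U := by
      refine ⟨?_, ?_, ?_⟩
      · rw [huv0]; nlinarith
      · rw [hpv0]; exact hx1
      · rw [hRp, huv0, hpv0]; nlinarith
    refine lt_of_lt_of_le (aux_pos n v0 hv0 U hU hv0U) (measure_mono ?_)
    rintro v ⟨⟨h1, h2, h3⟩, h4⟩
    refine ⟨?_, ⟨⟨⟨h4, h2⟩, fun h => ?_⟩, fun h => ?_⟩⟩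
    · have hb := hbes v h4
      have h5 : 0 < ⟪u, v⟫ ^ 2 := sq_pos_of_neg h1
      have h6 : 0 < g ⟪z, v⟫ := hg_pos _ ⟨by nlinarith, by nlinarith⟩
      simp only [Function.mem_support, f]
      have := mul_neg_of_pos_of_neg h6 h1
      intro h7
      linarith
    · have : 0 < ⟪u, v⟫ := h.2
      linarith
    · have : c < ⟪p, R v⟫ := h.1.2
      linarith
  · filter_upwards [ae_restrict_mem hDm] with v hv
    have h1 : ¬ 0 < ⟪u, v⟫ := fun h => hv.1.2 ⟨hv.1.1, h⟩
    have h2 := hg_nonneg _ (hzv v (hBs (hDB hv)))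
    simp only [f, Pi.zero_apply]
    nlinarith
  · exact (hfi.mono_set hDB).neg

/-- For `p ∈ Sⁿ`, `r ∈ (0, π/2)` and `z ∈ Sⁿ` with `z ≠ ±p`, letting
`u = -π_z(p)/|π_z(p)|` (the unit tangent vector at `z` in the plane of `p, z` with `u·p < 0`),
we have `∫_{B_{p,r}} g(z·v)(u·v) dv < 0`. -/
theorem statement3 (n : ℕ) (hn : 2 ≤ n)
    (g : ℝ → ℝ) (hg_cont : ContinuousOn g (Set.Icc (-1) 1))
    (hg_even : ∀ t, g (-t) = g t)
    (hg_nonneg : ∀ t ∈ Set.Icc (-1:ℝ) 1, 0 ≤ g t)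
    (hg_pos : ∀ t ∈ Set.Ioo (-1:ℝ) 1, 0 < g t)
    (p : EuclideanSpace ℝ (Fin (n + 1))) (hp : p ∈ sph n)
    (r : ℝ) (hr : r ∈ Set.Ioo 0 (π / 2))
    (z : EuclideanSpace ℝ (Fin (n + 1))) (hz : z ∈ sph n)
    (hzp : z ≠ p) (hzp' : z ≠ -p)
    (u : EuclideanSpace ℝ (Fin (n + 1)))
    (hu : u = -(‖proj n z p‖⁻¹ • proj n z p)) :
    (∫ v in gball n p r, g ⟪z, v⟫ * ⟪u, v⟫ ∂μH[(n:ℝ)]) < 0 := by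
  have hp1 : ‖p‖ = 1 := by simpa [sph] using hp
  have hz1 : ‖z‖ = 1 := by simpa [sph] using hz
  rw [aux_gball n p hp1 r hr]
  have hq0 : proj n z p ≠ 0 := by
    intro h
    have h1 : p = ⟪p, z⟫ • z := sub_eq_zero.1 h
    have h2 : |⟪p, z⟫| = 1 := by
      have h3 := congrArg norm h1
      rw [norm_smul, hp1, hz1, mul_one, Real.norm_eq_abs] at h3
      exact h3.symm
    rcases (abs_eq zero_le_one).1 h2 with h3 | h3
    · rw [h3, one_smul] at h1
      exact hzp h1.symm
    · rw [h3] at h1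
      apply hzp'
      rw [h1]; simp
  have hzq : ⟪z, proj n z p⟫ = 0 := by
    rw [proj, inner_sub_right, inner_smul_right, real_inner_self_eq_norm_sq, hz1,
      real_inner_comm]
    ring
  have hpq : ⟪p, proj n z p⟫ = ‖proj n z p‖ ^ 2 := by
    have h1 : p = proj n z p + ⟪p, z⟫ • z := by simp [proj]
    have h2 : ⟪proj n z p + ⟪p, z⟫ • z, proj n z p⟫ = ‖proj n z p‖ ^ 2 := by
      rw [inner_add_left, inner_smul_left, hzq, real_inner_self_eq_norm_sq]
      simp
    rwa [← h1] at h2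
  have hqn : 0 < ‖proj n z p‖ := norm_pos_iff.2 hq0
  refine aux_main n hn g hg_cont hg_nonneg hg_pos p z u hp1 hz1 ?_ ?_ ?_ (cos r) ?_ ?_
  · rw [hu, norm_neg, norm_smul, norm_inv, norm_norm, inv_mul_cancel₀ hqn.ne']
  · rw [hu, inner_neg_right, inner_smul_right, hzq]; simp
  · rw [hu, inner_neg_right, inner_smul_right, hpq, neg_lt_zero]
    positivity
  · exact cos_pos_of_mem_Ioo ⟨by linarith [hr.1, pi_pos], hr.2⟩
  · rw [← cos_zero]
    exact cos_lt_cos_of_nonneg_of_le_pi le_rfl (by linarith [hr.2, pi_pos]) hr.1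
end
end

section
/- Let n ≥ 2, p ∈ Sⁿ and r ∈ (0, π/2). A point z ∈ Sⁿ satisfies ∫_{B_{p,r}} g(z·v) π_z(v) dv = 0 (a vector-valued integral in ℝ^{n+1}) if and only if z = p or z = −p; that is, the critical points on Sⁿ of z ↦ ∫_{B_{p,r}} G(z·v) dv are exactly p and −p. -/
open MeasureTheory Real
open scoped RealInnerProductSpace

noncomputable section

abbrev EE (n : ℕ) := EuclideanSpace ℝ (Fin (n + 1))

/-- local graph parametrisation of the sphere -/
def gr (n : ℕ) (x : EE n) (y : (ℝ ∙ x)ᗮ) : EE n := (y : EE n) + (√(1 - ‖y‖ ^ 2)) • x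

lemma finrank_perp (n : ℕ) (x : EE n) (hx : ‖x‖ = 1) : Module.finrank ℝ (ℝ ∙ x)ᗮ = n := by
  have : Fact (Module.finrank ℝ (EE n) = n + 1) := ⟨by simp⟩
  exact Submodule.finrank_orthogonal_span_singleton (by rintro rfl; simp at hx)

lemma haar_perp (n : ℕ) (x : EE n) (hx : ‖x‖ = 1) :
    Measure.IsAddHaarMeasure (μH[(n:ℝ)] : Measure ((ℝ ∙ x)ᗮ : Submodule ℝ (EE n))) := by
  have := MeasureTheory.isAddHaarMeasure_hausdorffMeasure (E := ((ℝ ∙ x)ᗮ : Submodule ℝ (EE n)))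
  rwa [finrank_perp n x hx] at this

lemma gr_contDiffAt (n : ℕ) (x : EE n) : ContDiffAt ℝ 1 (gr n x) 0 := by
  have h2 : ContDiffAt ℝ 1 (fun y : (ℝ ∙ x)ᗮ => √(1 - ‖y‖ ^ 2)) 0 := by
    refine ContDiffAt.sqrt ?_ (by simp)
    exact (contDiff_const.sub (contDiff_norm_sq ℝ)).contDiffAt
  have h3 : ContDiffAt ℝ 1 (fun y : (ℝ ∙ x)ᗮ => (√(1 - ‖y‖ ^ 2)) • x) 0 := by
    fun_prop
  refine ContDiffAt.add ?_ h3
  · exact ((ℝ ∙ x)ᗮ.subtypeL.contDiff).contDiffAt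

lemma perp_inner (n : ℕ) (x : EE n) (y : (ℝ ∙ x)ᗮ) : ⟪x, (y : EE n)⟫ = 0 :=
  Submodule.mem_orthogonal_singleton_iff_inner_right.1 y.2

lemma gr_norm (n : ℕ) (x : EE n) (hx : ‖x‖ = 1) (y : (ℝ ∙ x)ᗮ) (hy : ‖y‖ ≤ 1) :
    ‖gr n x y‖ = 1 := by
  have h : ‖gr n x y‖ ^ 2 = 1 := by
    unfold gr
    rw [norm_add_sq_real, inner_smul_right, real_inner_comm, perp_inner, norm_smul, hx, mul_one,
      norm_of_nonneg (Real.sqrt_nonneg _), Real.sq_sqrt]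
    · simp
    · nlinarith [norm_nonneg y]
  nlinarith [norm_nonneg (gr n x y)]

lemma pr_gr (n : ℕ) (x : EE n) (y : (ℝ ∙ x)ᗮ) :
    (ℝ ∙ x)ᗮ.orthogonalProjectionOnto (gr n x y) = y := by
  unfold gr
  rw [map_add, map_smul]
  simp

lemma gr_pr (n : ℕ) (x : EE n) (hx : ‖x‖ = 1) (v : EE n) (hv : ‖v‖ = 1) (h : 0 ≤ ⟪x, v⟫) :
    gr n x ((ℝ ∙ x)ᗮ.orthogonalProjectionOnto v) = v := by
  have h1 : ((ℝ ∙ x)ᗮ.orthogonalProjectionOnto v : EE n) = v - ⟪x, v⟫ • x := by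
    rw [Submodule.coe_orthogonalProjectionOnto_apply, Submodule.starProjection_orthogonal_val,
      Submodule.starProjection_unit_singleton ℝ hx]
  have h2 : ‖(ℝ ∙ x)ᗮ.orthogonalProjectionOnto v‖ ^ 2 = 1 - ⟪x, v⟫ ^ 2 := by
    rw [Submodule.coe_norm, h1, norm_sub_sq_real, inner_smul_right, norm_smul, hx, hv,
      real_inner_comm, Real.norm_eq_abs, mul_one, sq_abs]
    ring
  unfold gr
  rw [h2, h1]
  simp [Real.sqrt_sq h]

lemma sph_finite (n : ℕ) : μH[(n:ℝ)] (sph n) < ⊤ := by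
  refine (isCompact_sphere (0 : EE n) 1).measure_lt_top_of_nhdsWithin ?_
  intro x hx
  have hx : ‖x‖ = 1 := by simpa using hx
  have := haar_perp n x hx
  obtain ⟨K, t, ht, hL⟩ := (gr_contDiffAt n x).exists_lipschitzOnWith
  obtain ⟨ε, hε, hb⟩ := Metric.mem_nhds_iff.1 ht
  refine ⟨gr n x '' Metric.ball 0 ε, ?_, ?_⟩
  · have hx0 : (ℝ ∙ x)ᗮ.orthogonalProjectionOnto x = 0 := by
      have := pr_gr n x 0
      rwa [show gr n x 0 = x by simp [gr]] at this
    have c1 : ContinuousAt (fun v => (ℝ ∙ x)ᗮ.orthogonalProjectionOnto v) x := by fun_prop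
    have c2 : ContinuousAt (fun v => ⟪x, v⟫) x := by fun_prop
    have e1 := c1.preimage_mem_nhds (t := Metric.ball 0 ε)
      (Metric.isOpen_ball.mem_nhds (by rw [hx0]; exact Metric.mem_ball_self hε))
    have e2 := c2.preimage_mem_nhds (t := Set.Ioi 0) (Ioi_mem_nhds (by simp [hx]))
    filter_upwards [mem_nhdsWithin_of_mem_nhds e1, mem_nhdsWithin_of_mem_nhds e2,
      self_mem_nhdsWithin] with v h1 h2 h3
    exact ⟨_, h1, gr_pr n x hx v (by simpa using h3) (le_of_lt h2)⟩
  · refine ((hL.mono hb).hausdorffMeasure_image_le (Nat.cast_nonneg n)).trans_lt ?_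
    refine ENNReal.mul_lt_top (ENNReal.rpow_lt_top_of_nonneg (Nat.cast_nonneg n) (by simp)) ?_
    exact measure_ball_lt_top

lemma sph_pos (n : ℕ) (U : Set (EE n)) (hU : IsOpen U) (x : EE n) (hx : ‖x‖ = 1) (hxU : x ∈ U) :
    0 < μH[(n:ℝ)] (U ∩ sph n) := by
  have := haar_perp n x hx
  have c := (gr_contDiffAt n x).continuousAt
  have h0 : gr n x 0 = x := by simp [gr]
  have e := c.preimage_mem_nhds (hU.mem_nhds (by rwa [h0]))
  obtain ⟨ε, hε, hb⟩ := Metric.mem_nhds_iff.1 e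
  have hsub : Metric.ball 0 (min ε 1) ⊆
      (fun v => (ℝ ∙ x)ᗮ.orthogonalProjectionOnto v) '' (U ∩ sph n) := by
    intro y hy
    have hy' := (lt_min_iff.1 (mem_ball_zero_iff.1 hy))
    refine ⟨gr n x y, ⟨hb (mem_ball_zero_iff.2 hy'.1), ?_⟩, pr_gr n x y⟩
    simpa [sph] using gr_norm n x hx y hy'.2.le
  have hL : LipschitzWith 1 (fun v => (ℝ ∙ x)ᗮ.orthogonalProjectionOnto v) :=
    Submodule.lipschitzWith_orthogonalProjectionOnto _
  have := hL.hausdorffMeasure_image_le (Nat.cast_nonneg n) (U ∩ sph n)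
  simp only [ENNReal.coe_one, ENNReal.one_rpow, one_mul] at this
  refine lt_of_lt_of_le ?_ ((measure_mono hsub).trans this)
  exact Metric.measure_ball_pos _ _ (by positivity)

lemma gball_iff (n : ℕ) (p v : EE n) (hp : ‖p‖ = 1) (r : ℝ) (hr : r ∈ Set.Ioo 0 (π / 2)) :
    v ∈ gball n p r ↔ ‖v‖ = 1 ∧ Real.cos r < ⟪p, v⟫ := by
  have h : v ∈ sph n ↔ ‖v‖ = 1 := by simp [sph]
  unfold gball
  rw [Set.mem_ofPred_eq, h]
  refine and_congr_right fun hv => ?_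
  have hle : |⟪p, v⟫| ≤ 1 := by simpa [hp, hv] using abs_real_inner_le_norm p v
  have hle := abs_le.1 hle
  constructor
  · intro h
    have := Real.cos_lt_cos_of_nonneg_of_le_pi (Real.arccos_nonneg _)
      (by linarith [hr.2, Real.pi_pos]) h
    rwa [Real.cos_arccos hle.1 hle.2] at this
  · intro h
    have := Real.arccos_lt_arccos (by linarith [Real.neg_one_le_cos r]) h hle.2
    rwa [Real.arccos_cos hr.1.le (by linarith [hr.2, Real.pi_pos])] at this

lemma gball_meas (n : ℕ) (p : EE n) (r : ℝ) : MeasurableSet (gball n p r) := by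
  unfold gball
  have h1 : MeasurableSet (sph n) := Metric.isClosed_sphere.measurableSet
  have h2 : IsOpen {v : EE n | Real.arccos ⟪p, v⟫ < r} :=
    isOpen_lt (Real.continuous_arccos.comp (by fun_prop)) continuous_const
  exact h1.inter h2.measurableSet

lemma gball_sub (n : ℕ) (p : EE n) (r : ℝ) : gball n p r ⊆ sph n := fun _ h => h.1

lemma intOn {F : Type*} [NormedAddCommGroup F] (n : ℕ) (f : EE n → F)
    (hf : ContinuousOn f (sph n)) : IntegrableOn f (sph n) μH[(n:ℝ)] :=
  hf.integrableOn_of_subset_isCompact (isCompact_sphere _ _)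
    Metric.isClosed_sphere.measurableSet subset_rfl (sph_finite n).ne

lemma setInt_refl {F : Type*} [NormedAddCommGroup F] [NormedSpace ℝ F] (n : ℕ)
    (T : EE n ≃ₗᵢ[ℝ] EE n) (f : EE n → F) (s : Set (EE n)) :
    ∫ v in T ⁻¹' s, f (T v) ∂μH[(n:ℝ)] = ∫ v in s, f v ∂μH[(n:ℝ)] :=
  MeasurePreserving.setIntegral_preimage_emb
    (T.toIsometryEquiv.measurePreserving_hausdorffMeasure n)
    (T.toHomeomorph.measurableEmbedding) f s

lemma back (n : ℕ) (g : ℝ → ℝ) (p : EE n) (hp : ‖p‖ = 1) (r : ℝ) (hr : r ∈ Set.Ioo 0 (π / 2))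
    (z : EE n) (hz : z = p ∨ z = -p) :
    (∫ v in gball n p r, g ⟪z, v⟫ • proj n z v ∂μH[(n:ℝ)]) = 0 := by
  let T := (ℝ ∙ p).reflection
  have hT : ∀ v, T v = (2 * ⟪p, v⟫) • p - v := by
    intro v
    simp only [T, Submodule.reflection_singleton_apply, hp]
    simp [two_smul, two_mul, add_smul]
  have hpT : ∀ v, ⟪p, T v⟫ = ⟪p, v⟫ := by
    intro v
    rw [hT, inner_sub_right, inner_smul_right, real_inner_self_eq_norm_sq, hp]; ring
  have hpre : T ⁻¹' gball n p r = gball n p r := by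
    ext v
    rw [Set.mem_preimage, gball_iff n p _ hp r hr, gball_iff n p _ hp r hr, hpT,
      LinearIsometryEquiv.norm_map]
  have key := setInt_refl n T (fun v => g ⟪z, v⟫ • proj n z v) (gball n p r)
  have hneg : ∀ v, g ⟪z, T v⟫ • proj n z (T v) = -(g ⟪z, v⟫ • proj n z v) := by
    intro v
    have h1 : ⟪z, T v⟫ = ⟪z, v⟫ := by
      rcases hz with rfl | rfl
      · exact hpT v
      · simp only [inner_neg_left, hpT]
    have h2 : proj n z (T v) = - proj n z v := by
      unfold proj
      rw [real_inner_comm, h1, real_inner_comm z v, hT]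
      rcases hz with rfl | rfl
      · rw [two_mul, add_smul]; abel
      · simp only [inner_neg_left, two_mul, add_smul, neg_smul, smul_neg]; abel
    rw [h1, h2, smul_neg]
  simp only [hneg, hpre, integral_neg] at key
  have h2 := eq_neg_iff_add_eq_zero.1 key.symm
  rw [← two_smul ℝ] at h2
  exact (smul_eq_zero.1 h2).resolve_left two_ne_zero

/-- a unit vector orthogonal to two given ones -/
lemma exists_perp (n : ℕ) (hn : 2 ≤ n) (p z : EE n) : ∃ u : EE n, ‖u‖ = 1 ∧ ⟪p, u⟫ = 0 ∧ ⟪z, u⟫ = 0 := by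
  let K := Submodule.span ℝ ({p, z} : Set (EE n))
  have hK : Module.finrank ℝ K ≤ 2 := by
    have := finrank_span_finset_le_card (R := ℝ) ({p, z} : Finset (EE n))
    have h2 := Finset.card_le_two (a := p) (b := z)
    simp only [Finset.coe_insert, Finset.coe_singleton] at this
    exact this.trans h2
  have hs := K.finrank_add_finrank_orthogonal
  have h3 : Module.finrank ℝ (EE n) = n + 1 := by simp
  have hne : Kᗮ ≠ ⊥ := by
    intro h
    rw [h, finrank_bot] at hs
    omega
  obtain ⟨y, hy, hy0⟩ := Submodule.exists_mem_ne_zero_of_ne_bot hne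
  have hy' : ‖y‖ ≠ 0 := norm_ne_zero_iff.2 hy0
  refine ⟨‖y‖⁻¹ • y, by simp [norm_smul, hy'], ?_, ?_⟩
  · rw [inner_smul_right, (Submodule.mem_orthogonal _ _).1 hy p (Submodule.subset_span (by simp)),
      mul_zero]
  · rw [inner_smul_right, (Submodule.mem_orthogonal _ _).1 hy z (Submodule.subset_span (by simp)),
      mul_zero]

lemma exists_c (a k : ℝ) (ha : 0 < a) (ha1 : a < 1) (hk : 0 < k) :
    ∃ c, a < c ∧ c < 1 ∧ c - k * c < a := by
  have h1 : ∀ᶠ c in nhdsWithin a (Set.Ioi a), c - k * c < a := by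
    apply Filter.Eventually.filter_mono nhdsWithin_le_nhds
    have : ContinuousAt (fun c : ℝ => c - k * c) a := by fun_prop
    exact this.eventually (gt_mem_nhds (by nlinarith [mul_pos hk ha]))
  have h2 : ∀ᶠ c in nhdsWithin a (Set.Ioi a), c < 1 :=
    Filter.Eventually.filter_mono nhdsWithin_le_nhds (gt_mem_nhds ha1)
  obtain ⟨c, hc1, hc2, hc3⟩ := (h1.and (h2.and self_mem_nhdsWithin)).exists
  exact ⟨c, hc3, hc2, hc1⟩

lemma ct_lt (c t : ℝ) (h0 : 0 < c) (h1 : c < 1) (h2 : -1 < t) (h3 : t < 1) :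
    -1 < c * t ∧ c * t < 1 := by
  constructor <;> nlinarith

set_option maxHeartbeats 1000000 in
lemma forw (n : ℕ) (hn : 2 ≤ n)
    (g : ℝ → ℝ) (hg_cont : ContinuousOn g (Set.Icc (-1) 1))
    (hg_nonneg : ∀ t ∈ Set.Icc (-1:ℝ) 1, 0 ≤ g t)
    (hg_pos : ∀ t ∈ Set.Ioo (-1:ℝ) 1, 0 < g t)
    (p : EE n) (hp : ‖p‖ = 1)
    (r : ℝ) (hr : r ∈ Set.Ioo 0 (π / 2))
    (z : EE n) (hz : ‖z‖ = 1) (h1 : z ≠ p) (h2 : z ≠ -p) :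
    (∫ v in gball n p r, g ⟪z, v⟫ • proj n z v ∂μH[(n:ℝ)]) ≠ 0 := by
  intro hI
  have hzz : ⟪z, z⟫ = 1 := by rw [real_inner_self_eq_norm_sq, hz]; norm_num
  have hpp : ⟪p, p⟫ = 1 := by rw [real_inner_self_eq_norm_sq, hp]; norm_num
  obtain ⟨t, ht⟩ : ∃ t, t = ⟪p, z⟫ := ⟨_, rfl⟩
  have ht' : ⟪z, p⟫ = t := by rw [ht, real_inner_comm]
  have hlt1 : t < 1 := by
    rw [ht]
    exact lt_of_le_of_ne (by simpa [hp, hz] using real_inner_le_norm p z)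
      (fun h => h1 ((inner_eq_one_iff_of_norm_eq_one hp hz).1 h).symm)
  have hlt2 : -1 < t := by
    have : ⟪p, -z⟫ < 1 := lt_of_le_of_ne
      (by simpa [hp, hz] using real_inner_le_norm p (-z))
      (fun h => h2 (by
        rw [(inner_eq_one_iff_of_norm_eq_one hp (by simpa using hz)).1 h, neg_neg]))
    rw [inner_neg_right, ← ht] at this
    linarith
  obtain ⟨w, hw⟩ : ∃ w, w = p - t • z := ⟨_, rfl⟩
  have hzw : ⟪z, w⟫ = 0 := by
    rw [hw, inner_sub_right, inner_smul_right, hzz, ht']; ring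
  have hpw : ⟪p, w⟫ = 1 - t ^ 2 := by
    rw [hw, inner_sub_right, inner_smul_right, hpp, ← ht]; ring
  have hww : ‖w‖ ^ 2 = 1 - t ^ 2 := by
    rw [← real_inner_self_eq_norm_sq]
    nth_rw 1 [hw]
    rw [inner_sub_left, inner_smul_left, hzw, hpw]; simp
  have hk : 0 < 1 - t ^ 2 := by nlinarith
  let R := (ℝ ∙ w)ᗮ.reflection
  have hR : ∀ v, R v = v - (2 * (⟪w, v⟫ / (1 - t ^ 2))) • w := by
    intro v
    simp only [R, Submodule.reflection_orthogonal_apply, Submodule.reflection_singleton_apply]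
    simp [hww, two_smul, two_mul, add_smul]
  have hwR : ∀ v, ⟪w, R v⟫ = -⟪w, v⟫ := by
    intro v
    rw [hR, inner_sub_right, inner_smul_right, real_inner_self_eq_norm_sq, hww]
    field_simp; ring
  have hzR : ∀ v, ⟪z, R v⟫ = ⟪z, v⟫ := by
    intro v
    rw [hR, inner_sub_right, inner_smul_right, hzw]; ring
  have hpR : ∀ v, ⟪p, R v⟫ = ⟪p, v⟫ - 2 * ⟪w, v⟫ := by
    intro v
    rw [hR, inner_sub_right, inner_smul_right, hpw]
    field_simp
  set B := gball n p r with hB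
  have hBm : MeasurableSet B := gball_meas n p r
  set A := R ⁻¹' B with hA
  have hAm : MeasurableSet A := R.continuous.measurable hBm
  have memB : ∀ v, v ∈ B ↔ ‖v‖ = 1 ∧ Real.cos r < ⟪p, v⟫ := fun v => gball_iff n p v hp r hr
  have memA : ∀ v, v ∈ A ↔ ‖v‖ = 1 ∧ Real.cos r < ⟪p, v⟫ - 2 * ⟪w, v⟫ := by
    intro v
    rw [hA, Set.mem_preimage, memB, hpR, LinearIsometryEquiv.norm_map]
  have hAs : A ⊆ sph n := fun v hv => by simpa [sph] using ((memA v).1 hv).1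
  have hBs : B ⊆ sph n := gball_sub n p r
  have hzv : ∀ v, ‖v‖ = 1 → ⟪z, v⟫ ∈ Set.Icc (-1 : ℝ) 1 := by
    intro v hv
    exact abs_le.1 (by simpa [hz, hv] using abs_real_inner_le_norm z v)
  have hgc : ContinuousOn (fun v => g ⟪z, v⟫) (sph n) := by
    refine hg_cont.comp (f := fun v : EE n => ⟪z, v⟫) (by fun_prop) ?_
    intro v hv
    exact hzv v (by simpa [sph] using hv)
  have hFi : IntegrableOn (fun v => g ⟪z, v⟫ • proj n z v) (sph n) μH[(n:ℝ)] := by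
    refine intOn n _ (hgc.smul ?_)
    unfold proj
    fun_prop
  obtain ⟨f, hf⟩ : ∃ f : EE n → ℝ, f = fun v => g ⟪z, v⟫ * ⟪w, v⟫ := ⟨_, rfl⟩
  have hfi : IntegrableOn f (sph n) μH[(n:ℝ)] := by
    rw [hf]
    exact intOn n _ (hgc.mul (by fun_prop))
  have hJ : ∫ v in B, f v ∂μH[(n:ℝ)] = 0 := by
    have e := integral_inner (𝕜 := ℝ) (hFi.mono_set hBs) w
    rw [hI, inner_zero_right] at e
    rw [← e]
    congr 1
    ext v
    rw [hf, inner_smul_right, proj, inner_sub_right, inner_smul_right, real_inner_comm z w, hzw]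
    simp
  have hJ2 : ∫ v in A, f v ∂μH[(n:ℝ)] = 0 := by
    have e := setInt_refl n R f B
    have : ∀ v, f (R v) = - f v := by
      intro v
      simp only [hf, hzR, hwR]; ring
    simp only [this, integral_neg, hJ] at e
    exact neg_eq_zero.1 e
  have e1 := integral_inter_add_sdiff hAm (hfi.mono_set hBs)
  have e2 := integral_inter_add_sdiff hBm (hfi.mono_set hAs)
  rw [Set.inter_comm] at e2
  have n1 : ∀ v ∈ B \ A, 0 ≤ f v := by
    rintro v ⟨hv, hv'⟩
    rw [memA] at hv'; rw [memB] at hv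
    rw [hf]
    refine mul_nonneg (hg_nonneg _ (hzv v hv.1)) ?_
    by_contra hc
    exact hv' ⟨hv.1, by linarith [hv.2]⟩
  have n2 : ∀ v ∈ A \ B, f v ≤ 0 := by
    rintro v ⟨hv, hv'⟩
    rw [memB] at hv'; rw [memA] at hv
    rw [hf]
    refine mul_nonpos_of_nonneg_of_nonpos (hg_nonneg _ (hzv v hv.1)) ?_
    by_contra hc
    exact hv' ⟨hv.1, by linarith [hv.2]⟩
  have i2 : ∫ v in A \ B, f v ∂μH[(n:ℝ)] ≤ 0 :=
    setIntegral_nonpos (hAm.diff hBm) n2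
  have i1 : 0 < ∫ v in B \ A, f v ∂μH[(n:ℝ)] := by
    rw [setIntegral_pos_iff_support_of_nonneg_ae
      ((ae_restrict_iff' (hBm.diff hAm)).2 (Filter.Eventually.of_forall n1))
      (hfi.mono_set (Set.sdiff_subset.trans hBs))]
    obtain ⟨u, hu, hpu, hzu⟩ := exists_perp n hn p z
    have hcr : 0 < Real.cos r := Real.cos_pos_of_mem_Ioo ⟨by linarith [hr.1, Real.pi_pos], hr.2⟩
    have hcr1 : Real.cos r < 1 := by
      have := Real.cos_lt_cos_of_nonneg_of_le_pi le_rfl (by linarith [hr.2, Real.pi_pos]) hr.1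
      simpa using this
    obtain ⟨c, hc1, hc2, hc3⟩ := exists_c (Real.cos r) (2 * (1 - t ^ 2)) hcr hcr1 (by linarith)
    have hct := ct_lt c t (by linarith) hc2 hlt2 hlt1
    let x : EE n := c • p + √(1 - c ^ 2) • u
    have hc0 : 0 ≤ 1 - c ^ 2 := by nlinarith
    have hpx : ⟪p, x⟫ = c := by
      simp only [x, inner_add_right, inner_smul_right, hpp, hpu]; ring
    have hzx : ⟪z, x⟫ = c * t := by
      simp only [x, inner_add_right, inner_smul_right, ht', hzu]; ring
    have hwx : ⟪w, x⟫ = c * (1 - t ^ 2) := by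
      rw [hw, inner_sub_left, inner_smul_left, hpx, hzx]; simp; ring
    have hx : ‖x‖ = 1 := by
      have : ‖x‖ ^ 2 = 1 := by
        simp only [x]
        rw [norm_add_sq_real, inner_smul_right, inner_smul_left, hpu, norm_smul, norm_smul, hp, hu,
          mul_one, mul_one, norm_of_nonneg (Real.sqrt_nonneg _), Real.sq_sqrt hc0,
          Real.norm_eq_abs, sq_abs]
        ring
      nlinarith [norm_nonneg x]
    let U : Set (EE n) := {v | Real.cos r < ⟪p, v⟫} ∩ ({v | ⟪p, v⟫ - 2 * ⟪w, v⟫ < Real.cos r} ∩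
      ({v | ⟪z, v⟫ < 1} ∩ {v | -1 < ⟪z, v⟫}))
    have hU : IsOpen U := by
      refine (isOpen_lt (by fun_prop) (by fun_prop)).inter
        ((isOpen_lt (by fun_prop) (by fun_prop)).inter
        ((isOpen_lt (by fun_prop) (by fun_prop)).inter (isOpen_lt (by fun_prop) (by fun_prop))))
    have hxU : x ∈ U := by
      refine ⟨?_, ?_, ?_, ?_⟩
      · simpa [hpx] using hc1
      · simp only [Set.mem_ofPred_eq, hpx, hwx]; linarith
      · simp only [Set.mem_ofPred_eq, hzx]; exact hct.2
      · simp only [Set.mem_ofPred_eq, hzx]; exact hct.1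
    refine (sph_pos n U hU x hx hxU).trans_le (measure_mono ?_)
    rintro v ⟨⟨ha, hb, hc, hd⟩, hv⟩
    have hv : ‖v‖ = 1 := by simpa [sph] using hv
    simp only [Set.mem_ofPred_eq] at ha hb hc hd
    refine ⟨?_, (memB v).2 ⟨hv, ha⟩, fun h => ?_⟩
    · rw [Function.mem_support, hf]
      exact mul_ne_zero (hg_pos _ ⟨hd, hc⟩).ne' (by linarith : 0 < ⟪w, v⟫).ne'
    · linarith [((memA v).1 h).2]
  linarith

/-- For `p ∈ Sⁿ` and `r ∈ (0, π/2)`, a point `z ∈ Sⁿ` satisfies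
`∫_{B_{p,r}} g(z·v) π_z(v) dv = 0` if and only if `z = p` or `z = -p`; i.e. the critical
points of `z ↦ ∫_{B_{p,r}} G(z·v) dv` on the sphere are exactly `±p`. -/
theorem statement4 (n : ℕ) (hn : 2 ≤ n)
    (g : ℝ → ℝ) (hg_cont : ContinuousOn g (Set.Icc (-1) 1))
    (hg_even : ∀ t, g (-t) = g t)
    (hg_nonneg : ∀ t ∈ Set.Icc (-1:ℝ) 1, 0 ≤ g t)
    (hg_pos : ∀ t ∈ Set.Ioo (-1:ℝ) 1, 0 < g t)
    (p : EuclideanSpace ℝ (Fin (n + 1))) (hp : p ∈ sph n)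
    (r : ℝ) (hr : r ∈ Set.Ioo 0 (π / 2))
    (z : EuclideanSpace ℝ (Fin (n + 1))) (hz : z ∈ sph n) :
    (∫ v in gball n p r, g ⟪z, v⟫ • proj n z v ∂μH[(n:ℝ)]) = 0 ↔ (z = p ∨ z = -p) := by

  have hp' : ‖p‖ = 1 := by simpa [sph] using hp
  have hz' : ‖z‖ = 1 := by simpa [sph] using hz
  constructor
  · intro h
    by_contra hc
    push Not at hc
    exact forw n hn g hg_cont hg_nonneg hg_pos p hp' r hr z hz' hc.1 hc.2 h
  · exact back n g p hp' r hr z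
end
end

section
/- Let n ≥ 2, let a, z ∈ Sⁿ with a·z = 0, and let ρ ∈ L¹(Sⁿ) with ρ ≥ 0 almost everywhere and ∫_{Sⁿ} ρ > 0. Then ∫_{Sⁿ} ρ(v) g(z·F_a(v)) (a · π_z(F_a(v))) dv < 0. -/
open MeasureTheory Real
open scoped RealInnerProductSpace

noncomputable section

theorem equator_null (n : ℕ) (hn : 2 ≤ n) (a : EuclideanSpace ℝ (Fin (n + 1))) (ha : a ∈ sph n) :
    μH[(n:ℝ)] {v | v ∈ sph n ∧ ⟪v, a⟫ = 0} = 0 := by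
  have hna : ‖a‖ = 1 := by simpa [sph] using ha
  have ha0 : a ≠ 0 := by
    intro h
    simp [h] at hna
  let K : Submodule ℝ (EuclideanSpace ℝ (Fin (n + 1))) := (ℝ ∙ a)ᗮ
  have hfin : Module.finrank ℝ K = n := by
    haveI : Fact (Module.finrank ℝ (EuclideanSpace ℝ (Fin (n + 1))) = n + 1) := ⟨by simp⟩
    exact Submodule.finrank_orthogonal_span_singleton ha0
  haveI : Nontrivial K := Module.nontrivial_of_finrank_pos (R := ℝ) (by omega)
  have hiso : Isometry (Subtype.val : K → EuclideanSpace ℝ (Fin (n + 1))) := isometry_subtype_coe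
  have himg : {v | v ∈ sph n ∧ ⟪v, a⟫ = 0} ⊆ (Subtype.val : K → _) '' (Metric.sphere (0 : K) 1) := by
    rintro v ⟨hv, hva⟩
    refine ⟨⟨v, ?_⟩, ?_, rfl⟩
    · rw [Submodule.mem_orthogonal_singleton_iff_inner_left]
      exact hva
    · simpa [sph] using hv
  refine measure_mono_null himg ?_
  rw [hiso.hausdorffMeasure_image (Or.inl (by positivity))]
  have h2 : μH[(Module.finrank ℝ K : ℝ)] (Metric.sphere (0 : K) 1) = 0 :=
    Measure.addHaar_sphere _ _ _
  rwa [hfin] at h2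

/-- For `a, z ∈ Sⁿ` with `a·z = 0` and `ρ ∈ L¹(Sⁿ)` nonnegative a.e. with
`∫_{Sⁿ} ρ > 0`, one has `∫_{Sⁿ} ρ(v) g(z·F_a v) (a · π_z(F_a v)) dv < 0`. -/
theorem statement5 (n : ℕ) (hn : 2 ≤ n)
    (g : ℝ → ℝ) (hg_cont : ContinuousOn g (Set.Icc (-1) 1))
    (hg_even : ∀ t, g (-t) = g t)
    (hg_nonneg : ∀ t ∈ Set.Icc (-1:ℝ) 1, 0 ≤ g t)
    (hg_pos : ∀ t ∈ Set.Ioo (-1:ℝ) 1, 0 < g t)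
    (a z : EuclideanSpace ℝ (Fin (n + 1))) (ha : a ∈ sph n) (hz : z ∈ sph n)
    (haz : ⟪a, z⟫ = 0)
    (ρ : EuclideanSpace ℝ (Fin (n + 1)) → ℝ)
    (hρ : Integrable ρ ((μH[(n:ℝ)]).restrict (sph n)))
    (hρ0 : ∀ᵐ v ∂(μH[(n:ℝ)]).restrict (sph n), 0 ≤ ρ v)
    (hρpos : 0 < ∫ v in sph n, ρ v ∂μH[(n:ℝ)]) :
    (∫ v in sph n, ρ v * g ⟪z, fold n a v⟫ * ⟪a, proj n z (fold n a v)⟫ ∂μH[(n:ℝ)]) < 0 := by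
  have hna : ‖a‖ = 1 := by simpa [sph] using ha
  have hnz : ‖z‖ = 1 := by simpa [sph] using hz
  have hza : ⟪z, a⟫ = 0 := by rw [real_inner_comm]; exact haz
  have hsm : MeasurableSet (sph n) := Metric.isClosed_sphere.measurableSet
  have key : ∀ v, ρ v * g ⟪z, fold n a v⟫ * ⟪a, proj n z (fold n a v)⟫
      = -(ρ v * (g ⟪z, v⟫ * |⟪v, a⟫|)) := by
    intro v
    have h1 : ⟪z, fold n a v⟫ = ⟪z, v⟫ := by
      unfold fold sphRefl
      split_ifs
      · rw [inner_sub_right, inner_smul_right, hza]; ring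
      · rfl
    have h2 : ⟪a, proj n z (fold n a v)⟫ = -|⟪v, a⟫| := by
      unfold proj
      rw [inner_sub_right, inner_smul_right, haz]
      unfold fold sphRefl
      split_ifs with h
      · rw [inner_sub_right, inner_smul_right, real_inner_self_eq_norm_sq, hna, abs_of_pos h,
          real_inner_comm]
        ring
      · rw [abs_of_nonpos (not_lt.mp h), real_inner_comm]
        ring
    rw [h1, h2]; ring
  simp_rw [key]
  rw [integral_neg, neg_lt_zero]
  have hmem : ∀ v ∈ sph n, ⟪z, v⟫ ∈ Set.Icc (-1:ℝ) 1 := by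
    intro v hv
    have hnv : ‖v‖ = 1 := by simpa [sph] using hv
    have := abs_real_inner_le_norm z v
    rw [hnz, hnv, mul_one] at this
    exact abs_le.mp this
  have hcont : ContinuousOn (fun v => g ⟪z, v⟫ * |⟪v, a⟫|) (sph n) := by
    refine ContinuousOn.mul ?_ (by fun_prop)
    exact hg_cont.comp (f := fun v => ⟪z, v⟫) (by fun_prop) hmem
  obtain ⟨C, hC⟩ := (isCompact_sphere (0 : EuclideanSpace ℝ (Fin (n + 1))) 1).exists_bound_of_continuousOn
    hcont
  have hint : Integrable (fun v => ρ v * (g ⟪z, v⟫ * |⟪v, a⟫|)) ((μH[(n:ℝ)]).restrict (sph n)) := by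
    refine hρ.mul_bdd (c := C) (hcont.aestronglyMeasurable hsm) ?_
    filter_upwards [ae_restrict_mem hsm] with v hv using hC v hv
  have hne : ∀ᵐ v ∂(μH[(n:ℝ)]).restrict (sph n), ⟪v, a⟫ ≠ 0 := by
    rw [ae_restrict_iff' hsm, ae_iff]
    convert equator_null n hn a ha using 2
    ext v
    simp
  have hpos : ∀ᵐ v ∂(μH[(n:ℝ)]).restrict (sph n), 0 < g ⟪z, v⟫ * |⟪v, a⟫| := by
    filter_upwards [ae_restrict_mem hsm, hne] with v hv hva
    have hnv : ‖v‖ = 1 := by simpa [sph] using hv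
    refine mul_pos (hg_pos _ ⟨lt_of_le_of_ne (hmem v hv).1 ?_, lt_of_le_of_ne (hmem v hv).2 ?_⟩)
      (abs_pos.mpr hva)
    · intro h
      have : z = -v := (inner_eq_one_iff_of_norm_eq_one (𝕜 := ℝ) hnz (by simpa using hnv)).mp
        (by rw [inner_neg_right, ← h]; norm_num)
      apply hva
      rw [this, inner_neg_left] at hza
      linarith
    · intro h
      have : z = v := (inner_eq_one_iff_of_norm_eq_one (𝕜 := ℝ) hnz hnv).mp h
      exact hva (this ▸ hza)
  have hnn : 0 ≤ᵐ[(μH[(n:ℝ)]).restrict (sph n)] fun v => ρ v * (g ⟪z, v⟫ * |⟪v, a⟫|) := by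
    filter_upwards [hρ0, hpos] with v h1 h2 using mul_nonneg h1 h2.le
  refine lt_of_le_of_ne (integral_nonneg_of_ae hnn) fun h0 => ?_
  have hz0 := (integral_eq_zero_iff_of_nonneg_ae hnn hint).mp h0.symm
  have : ρ =ᵐ[(μH[(n:ℝ)]).restrict (sph n)] 0 := by
    filter_upwards [hz0, hpos] with v h1 h2
    exact (mul_eq_zero.mp h1).resolve_right h2.ne'
  rw [integral_congr_ae this] at hρpos
  simp at hρpos
end
end
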